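/- arXiv:2311.08634 — 2 statements merged into one kernel-verified Lean document; each statement's English description precedes it below -/
import Mathlib

section
/- Every minimally 3/2-tough, claw-free graph has a vertex of degree 3. -/
open SimpleGraph

variable {V : Type*}

/-- `numComponents G S` is the number of connected components of `G − S`,
the graph obtained from `G` by deleting the vertices of `S`. -/
noncomputable def numComponents (G : SimpleGraph V) (S : Set V) : ℕ :=
  Nat.card ((G.induce Sᶜ).ConnectedComponent)

/-- `HasToughness G t` says that the toughness of `G` is exactly `t`, i.e.
`t = min { |S| / w(G−S) : S ⊆ V(G), w(G−S) ≥ 2 }`.  (For a complete graph no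
such `S` exists and this predicate never holds, matching `τ(G) = ∞`.) -/
def HasToughness [Fintype V] (G : SimpleGraph V) (t : ℚ) : Prop :=
  (∀ S : Finset V, 2 ≤ numComponents G ↑S →
      t ≤ (S.card : ℚ) / (numComponents G ↑S : ℚ)) ∧
  ∃ S : Finset V, 2 ≤ numComponents G ↑S ∧
      t = (S.card : ℚ) / (numComponents G ↑S : ℚ)

/-- `G` is minimally `t`-tough: `τ(G) = t` and `τ(G − e) < t` for every edge
`e` of `G` (i.e. some vertex set witnesses a ratio `< t` in `G − e`). -/
def MinimallyTough [Fintype V] (G : SimpleGraph V) (t : ℚ) : Prop :=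
  HasToughness G t ∧
  ∀ u v : V, G.Adj u v →
    ∃ S : Finset V, 2 ≤ numComponents (G.deleteEdges {s(u, v)}) ↑S ∧
      (S.card : ℚ) / (numComponents (G.deleteEdges {s(u, v)}) ↑S : ℚ) < t

/-- `G` is claw-free: it has no induced subgraph isomorphic to `K_{1,3}`. -/
def ClawFree (G : SimpleGraph V) : Prop :=
  ¬ ∃ v a b c : V, a ≠ b ∧ a ≠ c ∧ b ≠ c ∧
      G.Adj v a ∧ G.Adj v b ∧ G.Adj v c ∧
      ¬ G.Adj a b ∧ ¬ G.Adj a c ∧ ¬ G.Adj b c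

/-- The vertex connectivity `κ(G)` of a noncomplete graph: the least cardinality
of a vertex set whose deletion disconnects `G`. -/
noncomputable def vconn [Fintype V] (G : SimpleGraph V) : ℕ :=
  sInf {k | ∃ S : Finset V, S.card = k ∧ 2 ≤ numComponents G ↑S}

/-- The vertex set of the connected component of `G − S` containing `u`
(empty if `u ∈ S`). -/
def compOf (G : SimpleGraph V) (S : Set V) (u : V) : Set V :=
  {w | ∃ (hu : u ∈ Sᶜ) (hw : w ∈ Sᶜ), (G.induce Sᶜ).Reachable ⟨u, hu⟩ ⟨w, hw⟩}

/-- `Dset G S u` is the union of the components of `G − S` other than the one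
containing `u`. -/
def Dset (G : SimpleGraph V) (S : Set V) (u : V) : Set V :=
  Sᶜ \ compOf G S u

/-- `nbrsIn G X Y = N_X(Y)`: the set of vertices in `X − Y` adjacent (in `G`)
to some vertex of `Y`. -/
def nbrsIn (G : SimpleGraph V) (X Y : Set V) : Set V :=
  {x | x ∈ X \ Y ∧ ∃ y ∈ Y, G.Adj x y}

/-- The edge `uv` is a bridge of the graph `G − S`: both endpoints survive the
deletion of `S`, they are adjacent, and deleting the edge `uv` increases the
number of connected components of `G − S`. -/
def IsBridgeIn (G : SimpleGraph V) (S : Set V) (u v : V) : Prop :=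
  u ∉ S ∧ v ∉ S ∧ G.Adj u v ∧
    numComponents G S < numComponents (G.deleteEdges {s(u, v)}) S

/-- `GoodCut G t u v S`: `S` is a vertex set with `w(G−S) ≤ |S|/t`,
`w((G−e)−S) > |S|/t` and such that `e = uv` is a bridge in `G − S`. -/
def GoodCut [Fintype V] (G : SimpleGraph V) (t : ℚ) (u v : V) (S : Finset V) : Prop :=
  (numComponents G ↑S : ℚ) ≤ (S.card : ℚ) / t ∧
  (S.card : ℚ) / t < (numComponents (G.deleteEdges {s(u, v)}) ↑S : ℚ) ∧
  IsBridgeIn G ↑S u v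

/-- `S` is a minimum-cardinality vertex set as guaranteed by Lemma 2.2,
i.e. `S = S(e)` for the edge `e = uv`. -/
def IsMinGoodCut [Fintype V] (G : SimpleGraph V) (t : ℚ) (u v : V) (S : Finset V) : Prop :=
  GoodCut G t u v S ∧ ∀ S' : Finset V, GoodCut G t u v S' → S.card ≤ S'.card

/-- `x` is contained in some `2t`-vertex-cut of `G`. -/
def InTwoTCut [Fintype V] (G : SimpleGraph V) (t : ℚ) (x : V) : Prop :=
  ∃ T : Finset V, (T.card : ℚ) = 2 * t ∧ 2 ≤ numComponents G ↑T ∧ x ∈ T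

/-- A fragment of `G`: the vertex set of a connected component of `G − T` for
some minimum vertex cut `T` of `G`. -/
def IsGraphFragment [Fintype V] (G : SimpleGraph V) (A : Set V) : Prop :=
  ∃ (T : Finset V) (a : V), T.card = vconn G ∧ 2 ≤ numComponents G ↑T ∧
    a ∉ T ∧ A = compOf G ↑T a

/-- An atom of `G`: a fragment of minimum cardinality. -/
def IsGraphAtom [Fintype V] (G : SimpleGraph V) (A : Set V) : Prop :=
  IsGraphFragment G A ∧ ∀ B : Set V, IsGraphFragment G B → A.ncard ≤ B.ncard

section Helper
open scoped Classical
variable [Fintype V]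

/-- The open neighbourhood of a vertex set. -/
noncomputable def nb (G : SimpleGraph V) (X : Finset V) : Finset V :=
  Finset.univ.filter (fun y => y ∉ X ∧ ∃ x ∈ X, G.Adj x y)

lemma mem_nb {G : SimpleGraph V} {X : Finset V} {y : V} :
    y ∈ nb G X ↔ y ∉ X ∧ ∃ x ∈ X, G.Adj x y := by
  simp [nb]

lemma mem_nb_single {G : SimpleGraph V} {x y : V} : y ∈ nb G {x} ↔ G.Adj x y := by
  rw [mem_nb]
  constructor
  · rintro ⟨_, z, hz, h⟩
    rw [Finset.mem_singleton] at hz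
    exact hz ▸ h
  · intro h
    exact ⟨by simpa using h.ne', x, by simp, h⟩

/-- `c` is constant along edges outside `S`. -/
def Resp (G : SimpleGraph V) (S : Finset V) (c : V → V) : Prop :=
  ∀ x y, x ∉ S → y ∉ S → G.Adj x y → c x = c y

/-- Combinatorial form of being `3/2`-tough. -/
def Tgh (G : SimpleGraph V) : Prop :=
  ∀ (S : Finset V) (c : V → V), Resp G S c → 2 ≤ (Sᶜ.image c).card →
    3 * (Sᶜ.image c).card ≤ 2 * S.card

/-- Combinatorial form of edge-minimality. -/
def Mini (G : SimpleGraph V) : Prop :=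
  ∀ u v, G.Adj u v → ∃ (S : Finset V) (c : V → V),
    Resp (G.deleteEdges {s(u, v)}) S c ∧ 2 ≤ (Sᶜ.image c).card ∧
    2 * S.card < 3 * (Sᶜ.image c).card

lemma exists_color (G : SimpleGraph V) (S : Finset V) :
    ∃ c : V → V, Resp G S c ∧ (Sᶜ.image c).card = numComponents G ↑S := by
  let f : (G.induce (↑S : Set V)ᶜ).ConnectedComponent → V := fun C => (C.out : _).1
  have hf : Function.Injective f := by
    intro C D h
    have h2 : C.out = D.out := Subtype.ext h
    rw [← Quot.out_eq C, ← Quot.out_eq D, h2]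
  refine ⟨fun x => if h : x ∈ (↑S : Set V)ᶜ then
    f ((G.induce (↑S : Set V)ᶜ).connectedComponentMk ⟨x, h⟩) else x, ?_, ?_⟩
  · intro x y hx hy hxy
    have hx' : x ∈ (↑S : Set V)ᶜ := by simpa using hx
    have hy' : y ∈ (↑S : Set V)ᶜ := by simpa using hy
    simp only [hx', hy', dif_pos]
    congr 1
    apply ConnectedComponent.sound
    apply SimpleGraph.Adj.reachable
    simpa using hxy
  · have : (Sᶜ.image (fun x => if h : x ∈ (↑S : Set V)ᶜ then
        f ((G.induce (↑S : Set V)ᶜ).connectedComponentMk ⟨x, h⟩) else x))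
        = Finset.univ.image f := by
      ext y
      simp only [Finset.mem_image, Finset.mem_univ, true_and]
      constructor
      · rintro ⟨x, hx, rfl⟩
        have hx' : x ∈ (↑S : Set V)ᶜ := by simpa using hx
        exact ⟨_, by rw [dif_pos hx']⟩
      · rintro ⟨C, rfl⟩
        refine ⟨f C, ?_, ?_⟩
        · exact Finset.mem_compl.2 (fun h => C.out.2 (Finset.mem_coe.2 h))
        · have h1 : f C ∈ (↑S : Set V)ᶜ := C.out.2
          rw [dif_pos h1]
          congr 1
          exact Quot.out_eq C
    rw [this, Finset.card_image_of_injective _ hf, numComponents, Nat.card_eq_fintype_card,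
      Finset.card_univ]

lemma color_le (G : SimpleGraph V) (S : Finset V) (c : V → V) (hc : Resp G S c) :
    (Sᶜ.image c).card ≤ numComponents G ↑S := by
  have key : ∀ x y : ((↑S : Set V)ᶜ : Set V), (G.induce (↑S : Set V)ᶜ).Reachable x y →
      c x.1 = c y.1 := by
    rintro x y ⟨w⟩
    induction w with
    | nil => rfl
    | cons h _ ih =>
      rw [← ih]
      rename_i a b d _
      exact hc _ _ (fun h => a.2 (Finset.mem_coe.2 h))
        (fun h => b.2 (Finset.mem_coe.2 h)) (by simpa using h)
  let g : (G.induce (↑S : Set V)ᶜ).ConnectedComponent → V := fun C => c (C.out : _).1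
  have : Sᶜ.image c ⊆ Finset.univ.image g := by
    intro y hy
    obtain ⟨x, hx, rfl⟩ := Finset.mem_image.1 hy
    have hx' : x ∈ (↑S : Set V)ᶜ := by simpa using hx
    refine Finset.mem_image.2
      ⟨(G.induce (↑S : Set V)ᶜ).connectedComponentMk ⟨x, hx'⟩, Finset.mem_univ _, ?_⟩
    apply key _ ⟨x, hx'⟩
    apply ConnectedComponent.exact
    exact Quot.out_eq _
  calc _ ≤ _ := Finset.card_le_card this
    _ ≤ _ := Finset.card_image_le
    _ = _ := by rw [numComponents, Nat.card_eq_fintype_card, Finset.card_univ]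

lemma tgh_of {G : SimpleGraph V} (h : MinimallyTough G (3 / 2)) : Tgh G := by
  intro S c hc h2
  have h3 := color_le G S c hc
  have h4 := h.1.1 S (le_trans h2 h3)
  have h5 : (0 : ℚ) < (numComponents G ↑S : ℚ) := by
    exact_mod_cast (by omega : 0 < numComponents G ↑S)
  rw [le_div_iff₀ h5] at h4
  have h6 : (3 * numComponents G ↑S : ℚ) ≤ 2 * S.card := by linarith
  have h7 : 3 * numComponents G ↑S ≤ 2 * S.card := by exact_mod_cast h6
  omega

lemma tight_of {G : SimpleGraph V} (h : MinimallyTough G (3 / 2)) :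
    ∃ (S : Finset V) (c : V → V), Resp G S c ∧ 2 ≤ (Sᶜ.image c).card ∧
      2 * S.card ≤ 3 * (Sᶜ.image c).card := by
  obtain ⟨S, h2, h4⟩ := h.1.2
  obtain ⟨c, hc, h3⟩ := exists_color G S
  refine ⟨S, c, hc, by omega, ?_⟩
  have h5 : (0 : ℚ) < (numComponents G ↑S : ℚ) := by
    exact_mod_cast (by omega : 0 < numComponents G ↑S)
  rw [eq_div_iff h5.ne'] at h4
  have h6 : (2 * S.card : ℚ) ≤ 3 * numComponents G ↑S := by linarith
  rw [h3]
  exact_mod_cast h6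

lemma mini_of {G : SimpleGraph V} (h : MinimallyTough G (3 / 2)) : Mini G := by
  intro u v huv
  obtain ⟨S, h2, h4⟩ := h.2 u v huv
  obtain ⟨c, hc, h3⟩ := exists_color (G.deleteEdges {s(u, v)}) S
  refine ⟨S, c, hc, by omega, ?_⟩
  have h5 : (0 : ℚ) < (numComponents (G.deleteEdges {s(u, v)}) ↑S : ℚ) := by
    exact_mod_cast (by omega : 0 < numComponents (G.deleteEdges {s(u, v)}) ↑S)
  rw [div_lt_iff₀ h5] at h4
  have h6 : (2 * S.card : ℚ) < 3 * numComponents (G.deleteEdges {s(u, v)}) ↑S := by linarith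
  rw [h3]
  exact_mod_cast h6

/-- Unpacked form of minimality. -/
lemma mini' {G : SimpleGraph V} (ht : Tgh G) (hm : Mini G) {u v : V} (huv : G.Adj u v) :
    ∃ (S : Finset V) (c : V → V), u ∉ S ∧ v ∉ S ∧ c u ≠ c v ∧
      2 ≤ (Sᶜ.image c).card ∧ 2 * S.card < 3 * (Sᶜ.image c).card ∧
      (∀ x y, x ∉ S → y ∉ S → G.Adj x y → c x ≠ c y → (x = u ∧ y = v) ∨ (x = v ∧ y = u)) := by
  obtain ⟨S, c, hc, h2, h3⟩ := hm u v huv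
  have hc' : ∀ x y, x ∉ S → y ∉ S → G.Adj x y → c x ≠ c y →
      (x = u ∧ y = v) ∨ (x = v ∧ y = u) := by
    intro x y hx hy hxy hne
    by_contra hcon
    apply hne
    apply hc x y hx hy
    rw [SimpleGraph.deleteEdges_adj]
    refine ⟨hxy, ?_⟩
    simpa using hcon
  have hno : ¬ Resp G S c := fun hr => by
    have := ht S c hr h2
    omega
  have : ∃ x y, x ∉ S ∧ y ∉ S ∧ G.Adj x y ∧ c x ≠ c y := by
    by_contra hcon
    push Not at hcon
    exact hno (fun x y hx hy h => hcon x y hx hy h)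
  obtain ⟨x, y, hx, hy, hxy, hne⟩ := this
  rcases hc' x y hx hy hxy hne with ⟨rfl, rfl⟩ | ⟨rfl, rfl⟩
  · exact ⟨S, c, hx, hy, hne, h2, h3, hc'⟩
  · exact ⟨S, c, hy, hx, hne.symm, h2, h3, hc'⟩

/-- 3-connectivity. -/
lemma three_conn {G : SimpleGraph V} (ht : Tgh G) {X : Finset V} (hX : X.Nonempty)
    (hr : ∃ r, r ∉ X ∧ r ∉ nb G X) : 3 ≤ (nb G X).card := by
  obtain ⟨a, ha⟩ := hX
  obtain ⟨r, hr1, hr2⟩ := hr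
  have har : a ≠ r := fun h => hr1 (h ▸ ha)
  have h1 : ((nb G X)ᶜ.image (fun x => if x ∈ X then a else r)) = {a, r} := by
    ext y
    simp only [Finset.mem_image, Finset.mem_compl, Finset.mem_insert, Finset.mem_singleton]
    constructor
    · rintro ⟨x, _, rfl⟩
      split_ifs <;> simp
    · rintro (rfl | rfl)
      · exact ⟨y, fun h => (mem_nb.1 h).1 ha, by simp [ha]⟩
      · exact ⟨y, hr2, by simp [hr1]⟩
  have := ht (nb G X) (fun x => if x ∈ X then a else r) ?_ ?_
  · rw [h1, Finset.card_pair har] at this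
    omega
  · intro x y hx hy hxy
    rw [mem_nb] at hx hy
    by_cases h1 : x ∈ X <;> by_cases h2 : y ∈ X <;> simp only [h1, h2, if_true, if_false]
    · exact absurd ⟨h2, x, h1, hxy⟩ hy
    · exact absurd ⟨h1, y, h2, hxy.symm⟩ hx
  · rw [h1, Finset.card_pair har]

def Frag (G : SimpleGraph V) (X : Finset V) : Prop :=
  X.Nonempty ∧ (nb G X).card ≤ 3 ∧ ∃ r, r ∉ X ∧ r ∉ nb G X

def Atom (G : SimpleGraph V) (A : Finset V) : Prop :=
  Frag G A ∧ ∀ X, Frag G X → A.card ≤ X.card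

/-- Pairwise separated family. -/
def Separ (G : SimpleGraph V) (I : Finset V) (Q : V → Finset V) : Prop :=
  ∀ i ∈ I, ∀ j ∈ I, i ≠ j → ∀ x ∈ Q i, ∀ y ∈ Q j, x ≠ y ∧ ¬ G.Adj x y

lemma touch_le {G : SimpleGraph V} (hcf : ClawFree G) {I : Finset V} {Q : V → Finset V}
    (hs : Separ G I Q) (s : V) : (I.filter (fun i => s ∈ nb G (Q i))).card ≤ 2 := by
  by_contra hcon
  push Not at hcon
  obtain ⟨i, j, k, hi, hj, hk, hij, hik, hjk⟩ := Finset.two_lt_card_iff.1 hcon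
  simp only [Finset.mem_filter, mem_nb] at hi hj hk
  obtain ⟨hi, _, a, ha, hsa⟩ := hi
  obtain ⟨hj, _, b, hb, hsb⟩ := hj
  obtain ⟨hk, _, d, hd, hsd⟩ := hk
  have h1 := hs i hi j hj hij a ha b hb
  have h2 := hs i hi k hk hik a ha d hd
  have h3 := hs j hj k hk hjk b hb d hd
  exact hcf ⟨s, a, b, d, h1.1, h2.1, h3.1, hsa.symm, hsb.symm, hsd.symm, h1.2, h2.2, h3.2⟩

lemma double_count (G : SimpleGraph V) (S I : Finset V) (Q : V → Finset V) :
    ∑ i ∈ I, (S ∩ nb G (Q i)).card = ∑ s ∈ S, (I.filter (fun i => s ∈ nb G (Q i))).card := by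
  have := Finset.sum_card_bipartiteAbove_eq_sum_card_bipartiteBelow
    (s := I) (t := S) (fun i s => s ∈ nb G (Q i))
  simp only [Finset.bipartiteAbove, Finset.bipartiteBelow] at this
  rw [← this]
  apply Finset.sum_congr rfl
  intro i _
  congr 1

lemma count_le {G : SimpleGraph V} (hcf : ClawFree G) {I : Finset V} {Q : V → Finset V}
    (hs : Separ G I Q) (S : Finset V) : ∑ i ∈ I, (S ∩ nb G (Q i)).card ≤ 2 * S.card := by
  rw [double_count, mul_comm, ← smul_eq_mul]
  exact Finset.sum_le_card_nsmul _ _ _ (fun s _ => touch_le hcf hs s)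

lemma count_lt {G : SimpleGraph V} (hcf : ClawFree G) {I : Finset V} {Q : V → Finset V}
    (hs : Separ G I Q) (S : Finset V) {s i0 : V} (hsS : s ∈ S)
    (h : ∀ i ∈ I, i ≠ i0 → s ∉ nb G (Q i)) :
    ∑ i ∈ I, (S ∩ nb G (Q i)).card < 2 * S.card := by
  rw [double_count, mul_comm, ← smul_eq_mul, ← Finset.sum_const]
  apply Finset.sum_lt_sum (fun s _ => touch_le hcf hs s)
  refine ⟨s, hsS, ?_⟩
  have : I.filter (fun i => s ∈ nb G (Q i)) ⊆ {i0} := by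
    intro i hi
    rw [Finset.mem_filter] at hi
    by_contra hne
    exact h i hi.1 (by simpa using hne) hi.2
  have := Finset.card_le_card this
  simp at this
  omega

/-- Existence of a fragment. -/
lemma exists_frag {G : SimpleGraph V} (hcf : ClawFree G) (h : MinimallyTough G (3 / 2)) :
    ∃ X, Frag G X := by
  obtain ⟨S, c, hc, h2, h3⟩ := tight_of h
  set I := Sᶜ.image c with hI
  let Q : V → Finset V := fun i => Sᶜ.filter (fun x => c x = i)
  have hQ : ∀ i x, x ∈ Q i ↔ x ∉ S ∧ c x = i := by intro i x; simp [Q]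
  have hsep : Separ G I Q := by
    intro i _ j _ hij x hx y hy
    rw [hQ] at hx hy
    refine ⟨fun h => hij (by rw [← hx.2, ← hy.2, h]), fun h => hij ?_⟩
    rw [← hx.2, ← hy.2]
    exact hc x y hx.1 hy.1 h
  have hnb : ∀ i, nb G (Q i) ⊆ S := by
    intro i y hy
    rw [mem_nb] at hy
    obtain ⟨hy, x, hx, hxy⟩ := hy
    rw [hQ] at hx hy
    by_contra hyS
    exact hy ⟨hyS, by rw [← hx.2]; exact (hc x y hx.1 hyS hxy).symm⟩
  have hcount := count_le hcf hsep S
  have : ∃ i ∈ I, (S ∩ nb G (Q i)).card ≤ 3 := by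
    by_contra hcon
    push Not at hcon
    have : I.card • 4 ≤ ∑ i ∈ I, (S ∩ nb G (Q i)).card :=
      Finset.card_nsmul_le_sum _ _ _ (fun i hi => hcon i hi)
    simp at this
    omega
  obtain ⟨i, hi, hi3⟩ := this
  rw [Finset.inter_eq_right.2 (hnb i)] at hi3
  obtain ⟨j, hj, hji⟩ := Finset.exists_mem_ne (by omega : 1 < I.card) i
  obtain ⟨x, hx, hxi⟩ := Finset.mem_image.1 hi
  obtain ⟨y, hy, hyj⟩ := Finset.mem_image.1 hj
  refine ⟨Q i, ⟨x, (hQ _ _).2 ⟨by simpa using hx, hxi⟩⟩, hi3, y, ?_, ?_⟩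
  · rw [hQ]
    rintro ⟨_, h⟩
    exact hji (hyj ▸ h)
  · intro h
    have := hnb i h
    simp [this] at hy

lemma exists_atom {G : SimpleGraph V} (h : ∃ X, Frag G X) : ∃ A, Atom G A := by
  obtain ⟨X, hX⟩ := h
  obtain ⟨A, hA, hmin⟩ := Finset.exists_min_image (Finset.univ.filter (fun X => Frag G X))
    Finset.card ⟨X, by simpa using hX⟩
  refine ⟨A, by simpa using hA, fun Y hY => hmin Y (by simpa using hY)⟩

lemma card_three (X F T F' : Finset V) (h1 : ∀ x, x ∈ F ∨ x ∈ T ∨ x ∈ F')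
    (h2 : ∀ x ∈ F, x ∉ T) (h3 : ∀ x ∈ F, x ∉ F') (h4 : ∀ x ∈ T, x ∉ F') :
    X.card = (X ∩ F).card + (X ∩ T).card + (X ∩ F').card := by
  rw [← Finset.card_union_of_disjoint, ← Finset.card_union_of_disjoint]
  · congr 1
    ext x
    have := h1 x
    simp only [Finset.mem_union, Finset.mem_inter]
    tauto
  · rw [Finset.disjoint_left]
    intro x hx hx'
    simp only [Finset.mem_union, Finset.mem_inter] at hx hx'
    rcases hx with h | h
    · exact h3 x h.2 hx'.2
    · exact h4 x h.2 hx'.2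
  · rw [Finset.disjoint_left]
    intro x hx hx'
    simp only [Finset.mem_inter] at hx hx'
    exact h2 x hx.2 hx'.2

lemma nb_inter_card {G : SimpleGraph V} {X T Y T' : Finset V} (hX : nb G X ⊆ T)
    (hY : nb G Y ⊆ T') :
    (nb G (X ∩ Y)).card ≤ (X ∩ T').card + (T ∩ Y).card + (T ∩ T').card := by
  have : nb G (X ∩ Y) ⊆ (X ∩ T') ∪ (T ∩ Y) ∪ (T ∩ T') := by
    intro y hy
    rw [mem_nb] at hy
    obtain ⟨hy, x, hx, hxy⟩ := hy
    rw [Finset.mem_inter] at hx hy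
    have h1 : y ∈ X ∨ y ∈ T := by
      by_cases h : y ∈ X
      · exact Or.inl h
      · exact Or.inr (hX (mem_nb.2 ⟨h, x, hx.1, hxy⟩))
    have h2 : y ∈ Y ∨ y ∈ T' := by
      by_cases h : y ∈ Y
      · exact Or.inl h
      · exact Or.inr (hY (mem_nb.2 ⟨h, x, hx.2, hxy⟩))
    simp only [Finset.mem_union, Finset.mem_inter]
    tauto
  calc _ ≤ _ := Finset.card_le_card this
    _ ≤ _ := Finset.card_union_le _ _
    _ ≤ _ := Nat.add_le_add_right (Finset.card_union_le _ _) _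

/-- Complementary fragment. -/
lemma frag_compl {G : SimpleGraph V} {X : Finset V} (hX : Frag G X) :
    Frag G (X ∪ nb G X)ᶜ ∧ nb G (X ∪ nb G X)ᶜ ⊆ nb G X := by
  have hsub : nb G (X ∪ nb G X)ᶜ ⊆ nb G X := by
    intro y hy
    rw [mem_nb] at hy
    obtain ⟨hy, x, hx, hxy⟩ := hy
    simp only [Finset.mem_compl, Finset.mem_union, not_or] at hx hy
    by_contra hcon
    have hyX : y ∈ X := by tauto
    exact hx.2 (mem_nb.2 ⟨hx.1, y, hyX, hxy.symm⟩)
  obtain ⟨⟨a, ha⟩, h3, r, hr1, hr2⟩ := hX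
  refine ⟨⟨⟨r, by simp [hr1, hr2]⟩, le_trans (Finset.card_le_card hsub) h3, a, ?_, ?_⟩, hsub⟩
  · simp [ha]
  · intro h
    exact (mem_nb.1 (hsub h)).1 ha

/-- Mader's lemma: an atom with at least two vertices avoids all minimum cuts. -/
lemma mader {G : SimpleGraph V} (ht : Tgh G) {A F : Finset V} (hA : Atom G A)
    (hA2 : 2 ≤ A.card) (hF : Frag G F) {x : V} (hx : x ∈ nb G F) : x ∉ A := by
  intro hxA
  obtain ⟨hR, hRT⟩ := frag_compl hA.1
  obtain ⟨hF', hFT⟩ := frag_compl hF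
  set T := nb G A with hT
  set T' := nb G F with hT'
  set R := (A ∪ T)ᶜ with hRdef
  set F' := (F ∪ T')ᶜ with hFdef
  have p1 : ∀ x, x ∈ F ∨ x ∈ T' ∨ x ∈ F' := by
    intro x; simp only [hFdef, Finset.mem_compl, Finset.mem_union]; tauto
  have p2 : ∀ x ∈ F, x ∉ T' := fun x h h' => (mem_nb.1 h').1 h
  have p3 : ∀ x ∈ F, x ∉ F' := by
    intro x; simp only [hFdef, Finset.mem_compl, Finset.mem_union]; tauto
  have p4 : ∀ x ∈ T', x ∉ F' := by
    intro x; simp only [hFdef, Finset.mem_compl, Finset.mem_union]; tauto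
  have q1 : ∀ x, x ∈ A ∨ x ∈ T ∨ x ∈ R := by
    intro x; simp only [hRdef, Finset.mem_compl, Finset.mem_union]; tauto
  have q2 : ∀ x ∈ A, x ∉ T := fun x h h' => (mem_nb.1 h').1 h
  have q3 : ∀ x ∈ A, x ∉ R := by
    intro x; simp only [hRdef, Finset.mem_compl, Finset.mem_union]; tauto
  have q4 : ∀ x ∈ T, x ∉ R := by
    intro x; simp only [hRdef, Finset.mem_compl, Finset.mem_union]; tauto
  have e1 := card_three A F T' F' p1 p2 p3 p4
  have e2 := card_three T F T' F' p1 p2 p3 p4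
  have e3 := card_three R F T' F' p1 p2 p3 p4
  have e4 := card_three F A T R q1 q2 q3 q4
  have e5 := card_three T' A T R q1 q2 q3 q4
  have e6 := card_three F' A T R q1 q2 q3 q4
  rw [Finset.inter_comm F, Finset.inter_comm F, Finset.inter_comm F] at e4
  rw [Finset.inter_comm T', Finset.inter_comm T', Finset.inter_comm T'] at e5
  rw [Finset.inter_comm F', Finset.inter_comm F', Finset.inter_comm F'] at e6
  have t1 : T.card ≤ 3 := hA.1.2.1
  have t2 : T'.card ≤ 3 := hF.2.1
  have m1 := hA.2 F hF
  have m2 := hA.2 F' hF'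
  have m3 := hA.2 R hR
  have hAT : 1 ≤ (A ∩ T').card :=
    Finset.card_pos.2 ⟨x, Finset.mem_inter.2 ⟨hxA, hx⟩⟩
  obtain ⟨a, ha⟩ := hA.1.1
  obtain ⟨r, hr⟩ := hR.1
  have hra : r ∉ A := fun h => q3 r h hr
  have hrT : r ∉ T := fun h => q4 r h hr
  -- corners in A
  have cA : ∀ Y, nb G Y ⊆ T' → (A ∩ Y).card < A.card →
      (A ∩ Y).card = 0 ∨ 4 ≤ (A ∩ T').card + (T ∩ Y).card + (T ∩ T').card := by
    intro Y hY hlt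
    rcases Finset.eq_empty_or_nonempty (A ∩ Y) with h0 | h0
    · left; simp [h0]
    right
    have h1 := nb_inter_card (le_refl T : nb G A ⊆ T) hY
    by_contra hcon
    have : Frag G (A ∩ Y) := by
      refine ⟨h0, by omega, r, fun h => hra (Finset.mem_inter.1 h).1, fun h => ?_⟩
      obtain ⟨_, y, hy, hyr⟩ := mem_nb.1 h
      exact hrT (mem_nb.2 ⟨hra, y, (Finset.mem_inter.1 hy).1, hyr⟩)
    have := hA.2 _ this
    omega
  have cR : ∀ Y, nb G Y ⊆ T' →
      (R ∩ Y).card = 0 ∨ 3 ≤ (R ∩ T').card + (T ∩ Y).card + (T ∩ T').card := by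
    intro Y hY
    rcases Finset.eq_empty_or_nonempty (R ∩ Y) with h0 | h0
    · left; simp [h0]
    right
    have h1 := nb_inter_card hRT hY
    refine le_trans (three_conn ht h0 ⟨a, fun h => q3 a ha (Finset.mem_inter.1 h).1,
      fun h => ?_⟩) h1
    obtain ⟨_, y, hy, hya⟩ := mem_nb.1 h
    have hyR := (Finset.mem_inter.1 hy).1
    exact q2 a ha (hRT (mem_nb.2 ⟨q3 a ha, y, hyR, hya⟩))
  have c1 := cA F (le_refl T') (by omega)
  have c2 := cA F' hFT (by omega)
  have c3 := cR F (le_refl T')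
  have c4 := cR F' hFT
  omega

lemma deg_four {G : SimpleGraph V} (ht : Tgh G) {A : Finset V} (hA : Frag G A)
    (hd : ∀ v, (nb G {v}).card ≠ 3) (v : V) : 4 ≤ (nb G {v}).card := by
  have := hd v
  by_cases h : ∃ r, r ∉ ({v} : Finset V) ∧ r ∉ nb G {v}
  · have := three_conn ht (Finset.singleton_nonempty v) h
    omega
  · push Not at h
    have h1 : Finset.univ ⊆ {v} ∪ nb G {v} := by
      intro x _
      have := h x
      rw [Finset.mem_union]
      tauto
    have h2 := Finset.card_le_card h1
    have h3 := Finset.card_union_le {v} (nb G {v})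
    rw [Finset.card_singleton] at h3
    have h4 := three_conn ht hA.1 hA.2.2
    obtain ⟨r, hr1, hr2⟩ := hA.2.2
    have h5 := Finset.card_le_card (Finset.subset_univ (insert r (A ∪ nb G A)))
    rw [Finset.card_insert_of_notMem (by simp [hr1, hr2]), Finset.card_union_of_disjoint] at h5
    · have := Finset.card_pos.2 hA.1
      omega
    · rw [Finset.disjoint_left]
      exact fun x h h' => (mem_nb.1 h').1 h

/-- Connectivity of atoms. -/
lemma atom_conn {G : SimpleGraph V} {A X : Finset V} (hA : Atom G A)
    (hX : (A ∩ X).Nonempty) (h : ∀ x ∈ A, ∀ y ∈ A, x ∈ X → y ∉ X → ¬ G.Adj x y) : A ⊆ X := by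
  obtain ⟨r, hr1, hr2⟩ := hA.1.2.2
  have hsub : nb G (A ∩ X) ⊆ nb G A := by
    intro y hy
    obtain ⟨hy, x, hx, hxy⟩ := mem_nb.1 hy
    rw [Finset.mem_inter] at hx hy
    refine mem_nb.2 ⟨fun hyA => ?_, x, hx.1, hxy⟩
    exact h x hx.1 y hyA hx.2 (fun hyX => hy ⟨hyA, hyX⟩) hxy
  have : Frag G (A ∩ X) := ⟨hX, le_trans (Finset.card_le_card hsub) hA.1.2.1, r,
    fun h => hr1 (Finset.mem_inter.1 h).1, fun h => hr2 (hsub h)⟩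
  have h1 := hA.2 _ this
  have h2 := Finset.eq_of_subset_of_card_le Finset.inter_subset_left h1
  exact Finset.inter_eq_left.1 h2

lemma card_nb_le {G : SimpleGraph V} {X S : Finset V} {w : V} (h : nb G X ⊆ insert w S) :
    (nb G X).card ≤ (S ∩ nb G X).card + 1 := by
  have : nb G X ⊆ insert w (S ∩ nb G X) := by
    intro y hy
    have := h hy
    rw [Finset.mem_insert] at this ⊢
    rw [Finset.mem_inter]
    tauto
  exact le_trans (Finset.card_le_card this) (Finset.card_insert_le _ _)

lemma card_nb_ge_three {G : SimpleGraph V} (ht : Tgh G) {A X S : Finset V} {w : V}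
    (hA : Atom G A) (hA2 : 2 ≤ A.card) (hX : X.Nonempty) (hr : ∃ r, r ∉ X ∧ r ∉ nb G X)
    (hw : w ∈ A) (h : nb G X ⊆ insert w S) : 3 ≤ (S ∩ nb G X).card := by
  have h3 := three_conn ht hX hr
  have h4 := card_nb_le h
  by_cases hwX : w ∈ nb G X
  · by_contra hcon
    have : Frag G X := ⟨hX, by omega, hr⟩
    exact mader ht hA hA2 this hwX hw
  · have : nb G X ⊆ S := by
      intro y hy
      have h5 := h hy
      rw [Finset.mem_insert] at h5
      rcases h5 with rfl | h5
      · exact absurd hy hwX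
      · exact h5
    rwa [Finset.inter_eq_right.2 this]

set_option maxHeartbeats 1600000 in
/-- For an edge touching the atom, the critical cut isolates the edge. -/
lemma isolate {G : SimpleGraph V} (ht : Tgh G) (hm : Mini G) (hcf : ClawFree G)
    {A : Finset V} (hA : Atom G A) (hA2 : 2 ≤ A.card) (hd : ∀ x, 4 ≤ (nb G {x}).card)
    {u v : V} (huA : u ∈ A) (huv : G.Adj u v) :
    ∃ (S I : Finset V) (Q : V → Finset V) (i0 : V), i0 ∈ I ∧ Q i0 = {u, v} ∧
      (∀ i ∈ I, (Q i).Nonempty) ∧ Separ G I Q ∧ (∀ i ∈ I, nb G (Q i) ⊆ S) ∧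
      (∀ i ∈ I, ∀ x ∈ Q i, x ∉ S) ∧ 2 ≤ I.card ∧ 2 * S.card ≤ 3 * I.card + 2 := by
  obtain ⟨S, c, huS, hvS, hcuv, h2, h3, hc⟩ := mini' ht hm huv
  have huv' : u ≠ v := huv.ne
  set I := Sᶜ.image c with hI
  let P : V → Finset V := fun i => Sᶜ.filter (fun x => c x = i)
  have hP : ∀ i x, x ∈ P i ↔ x ∉ S ∧ c x = i := by intro i x; simp [P]
  have huP : u ∈ P (c u) := (hP _ _).2 ⟨huS, rfl⟩
  have hvP : v ∈ P (c v) := (hP _ _).2 ⟨hvS, rfl⟩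
  have huI : c u ∈ I := Finset.mem_image_of_mem _ (by simpa using huS)
  have hvI : c v ∈ I := Finset.mem_image_of_mem _ (by simpa using hvS)
  have hPne : ∀ i ∈ I, (P i).Nonempty := by
    intro i hi
    obtain ⟨x, hx, hxi⟩ := Finset.mem_image.1 hi
    exact ⟨x, (hP _ _).2 ⟨by simpa using hx, hxi⟩⟩
  have hPnb : ∀ i, i ≠ c u → i ≠ c v → nb G (P i) ⊆ S := by
    intro i hiu hiv y hy
    obtain ⟨hy, x, hx, hxy⟩ := mem_nb.1 hy
    rw [hP] at hx hy
    by_contra hyS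
    rcases hc x y hx.1 hyS hxy (fun h => hy ⟨hyS, by rw [← h, hx.2]⟩) with ⟨rfl, _⟩ | ⟨rfl, _⟩
    · exact hiu hx.2.symm
    · exact hiv hx.2.symm
  have hUnb : nb G ((P (c u)).erase u) ⊆ insert u S := by
    intro y hy
    obtain ⟨hy, x, hx, hxy⟩ := mem_nb.1 hy
    rw [Finset.mem_erase, hP] at hx hy
    rw [Finset.mem_insert]
    by_contra hcon
    rw [not_or] at hcon
    rcases hc x y hx.2.1 hcon.2 hxy
      (fun h => hy ⟨hcon.1, hcon.2, by rw [← h, hx.2.2]⟩) with ⟨rfl, _⟩ | ⟨_, rfl⟩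
    · exact hx.1 rfl
    · exact hcon.1 rfl
  have hVnb : nb G ((P (c v)).erase v) ⊆ insert v S := by
    intro y hy
    obtain ⟨hy, x, hx, hxy⟩ := mem_nb.1 hy
    rw [Finset.mem_erase, hP] at hx hy
    rw [Finset.mem_insert]
    by_contra hcon
    rw [not_or] at hcon
    rcases hc x y hx.2.1 hcon.2 hxy
      (fun h => hy ⟨hcon.1, hcon.2, by rw [← h, hx.2.2]⟩) with ⟨_, rfl⟩ | ⟨rfl, _⟩
    · exact hcon.1 rfl
    · exact hx.1 rfl
  have hU1nb : P (c u) = {u} → nb G {u} ⊆ insert v S := by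
    intro h1 y hy
    rw [mem_nb_single] at hy
    rw [Finset.mem_insert]
    by_contra hcon
    rw [not_or] at hcon
    have hyU : y ∉ P (c u) := by rw [h1]; simpa using hy.ne'
    rcases hc u y huS hcon.2 hy
      (fun h => hyU ((hP _ _).2 ⟨hcon.2, h.symm⟩)) with ⟨_, rfl⟩ | ⟨h, _⟩
    · exact hcon.1 rfl
    · exact huv' h
  have hV1nb : P (c v) = {v} → nb G {v} ⊆ insert u S := by
    intro h1 y hy
    rw [mem_nb_single] at hy
    rw [Finset.mem_insert]
    by_contra hcon
    rw [not_or] at hcon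
    have hyU : y ∉ P (c v) := by rw [h1]; simpa using hy.ne'
    rcases hc v y hvS hcon.2 hy
      (fun h => hyU ((hP _ _).2 ⟨hcon.2, h.symm⟩)) with ⟨h, _⟩ | ⟨_, rfl⟩
    · exact huv' h.symm
    · exact hcon.1 rfl
  have hUr : ∃ r, r ∉ (P (c u)).erase u ∧ r ∉ nb G ((P (c u)).erase u) := by
    refine ⟨v, ?_, fun h => ?_⟩
    · rw [Finset.mem_erase, hP]
      rintro ⟨_, _, h⟩
      exact hcuv h.symm
    · have := hUnb h
      rw [Finset.mem_insert] at this
      rcases this with h | h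
      · exact huv' h.symm
      · exact hvS h
  have hVr : ∃ r, r ∉ (P (c v)).erase v ∧ r ∉ nb G ((P (c v)).erase v) := by
    refine ⟨u, ?_, fun h => ?_⟩
    · rw [Finset.mem_erase, hP]
      rintro ⟨_, _, h⟩
      exact hcuv h
    · have := hVnb h
      rw [Finset.mem_insert] at this
      rcases this with h | h
      · exact huv' h
      · exact huS h
  have herase : ∀ (w : V) (X : Finset V), w ∈ X → X ≠ {w} → (X.erase w).Nonempty := by
    intro w X hw hX
    rw [Finset.nonempty_iff_ne_empty]
    intro h
    rw [Finset.erase_eq_empty_iff] at h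
    rcases h with h | h
    · simp [h] at hw
    · exact hX h
  have hU3 : P (c u) ≠ {u} → 3 ≤ (S ∩ nb G ((P (c u)).erase u)).card := fun h =>
    card_nb_ge_three ht hA hA2 (herase _ _ huP h) hUr huA hUnb
  have hU3' : P (c u) = {u} → 3 ≤ (S ∩ nb G {u}).card := fun h => by
    have := card_nb_le (hU1nb h)
    have := hd u
    omega
  have hV3' : P (c v) = {v} → 3 ≤ (S ∩ nb G {v}).card := fun h => by
    have := card_nb_le (hV1nb h)
    have := hd v
    omega
  have hk : 3 ≤ I.card := by
    by_contra hcon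
    by_cases h : P (c u) = {u}
    · have := hU3' h
      have := Finset.card_le_card (Finset.inter_subset_left : S ∩ nb G {u} ⊆ S)
      omega
    · have := hU3 h
      have := Finset.card_le_card
        (Finset.inter_subset_left : S ∩ nb G ((P (c u)).erase u) ⊆ S)
      omega
  by_cases hUV : P (c u) = {u} ∧ P (c v) = {v}
  · obtain ⟨hU, hV⟩ := hUV
    have hmemI : ∀ i ∈ I.erase (c v), i = c u ∨ (i ≠ c u ∧ i ≠ c v) := by
      intro i hi
      rw [Finset.mem_erase] at hi
      by_cases h : i = c u
      · exact Or.inl h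
      · exact Or.inr ⟨h, hi.1⟩
    refine ⟨S, I.erase (c v), fun i => if i = c u then {u, v} else P i, c u,
      Finset.mem_erase.2 ⟨hcuv, huI⟩, by simp, ?_, ?_, ?_, ?_, ?_, ?_⟩
    · intro i hi
      rcases hmemI i hi with rfl | ⟨h, _⟩
      · simp
      · simp only [h, if_false]
        exact hPne i (Finset.mem_erase.1 hi).2
    · have key : ∀ j, j ≠ c u → j ≠ c v → ∀ x ∈ ({u, v} : Finset V), ∀ y ∈ P j,
          x ≠ y ∧ ¬ G.Adj x y := by
        intro j hj1 hj2 x hx y hy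
        have hne : x ≠ y := by
          rw [hP] at hy
          simp only [Finset.mem_insert, Finset.mem_singleton] at hx
          rintro rfl
          rcases hx with rfl | rfl
          · exact hj1 hy.2.symm
          · exact hj2 hy.2.symm
        refine ⟨hne, fun hxy => ?_⟩
        have hx' : x ∉ P j := by
          rw [hP]
          simp only [Finset.mem_insert, Finset.mem_singleton] at hx
          rcases hx with rfl | rfl
          · exact fun h => hj1 h.2.symm
          · exact fun h => hj2 h.2.symm
        have := hPnb j hj1 hj2 (mem_nb.2 ⟨hx', y, hy, hxy.symm⟩)
        simp only [Finset.mem_insert, Finset.mem_singleton] at hx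
        rcases hx with rfl | rfl
        · exact huS this
        · exact hvS this
      intro i hi j hj hij x hx y hy
      rcases hmemI i hi with rfl | ⟨h1, h1'⟩ <;> rcases hmemI j hj with rfl | ⟨h2, h2'⟩
      · exact absurd rfl hij
      · simp only [h2, if_false, if_true] at hx hy
        exact key j h2 h2' x hx y hy
      · simp only [h1, if_false, if_true] at hx hy
        have := key i h1 h1' y hy x hx
        exact ⟨this.1.symm, fun h => this.2 h.symm⟩
      · simp only [h1, h2, if_false] at hx hy
        have h5 := (hP _ _).1 hx
        have h6 := (hP _ _).1 hy
        refine ⟨?_, fun hxy => ?_⟩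
        · rintro rfl
          exact hij (h5.2.symm.trans h6.2)
        · have := hPnb i h1 h1' (mem_nb.2 ⟨fun h => hij (by
            rw [← h6.2]; exact ((hP _ _).1 h).2.symm), x, hx, hxy⟩)
          exact h6.1 this
    · intro i hi
      rcases hmemI i hi with rfl | ⟨h1, h1'⟩
      · simp only [if_true]
        intro y hy
        obtain ⟨hy, x, hx, hxy⟩ := mem_nb.1 hy
        simp only [Finset.mem_insert, Finset.mem_singleton, not_or] at hx hy
        rcases hx with rfl | rfl
        · have := hU1nb hU (mem_nb_single.2 hxy)
          rw [Finset.mem_insert] at this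
          exact this.resolve_left hy.2
        · have := hV1nb hV (mem_nb_single.2 hxy)
          rw [Finset.mem_insert] at this
          exact this.resolve_left hy.1
      · simp only [h1, if_false]
        exact hPnb i h1 h1'
    · intro i hi x hx
      rcases hmemI i hi with rfl | ⟨h1, h1'⟩
      · simp only [if_true, Finset.mem_insert, Finset.mem_singleton] at hx
        rcases hx with rfl | rfl
        · exact huS
        · exact hvS
      · simp only [h1, if_false] at hx
        exact ((hP _ _).1 hx).1
    · rw [Finset.card_erase_of_mem hvI]
      omega
    · rw [Finset.card_erase_of_mem hvI]
      omega
  exfalso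
  let Z : Finset V := Finset.univ.filter
    (fun x => (x = u ∧ P (c u) ≠ {u}) ∨ (x = v ∧ P (c v) ≠ {v}))
  have hZ : ∀ x, x ∈ Z ↔ (x = u ∧ P (c u) ≠ {u}) ∨ (x = v ∧ P (c v) ≠ {v}) := by
    intro x; simp [Z]
  let Q : V → Finset V := fun i => P i \ Z
  have hQP : ∀ i x, x ∈ Q i → x ∉ S ∧ c x = i := by
    intro i x hx
    exact (hP _ _).1 (Finset.mem_sdiff.1 hx).1
  have hQi : ∀ i, i ≠ c u → i ≠ c v → Q i = P i := by
    intro i h1 h2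
    ext x
    simp only [Q, Finset.mem_sdiff, hZ, hP]
    constructor
    · exact fun h => h.1
    · intro h
      refine ⟨h, ?_⟩
      rintro (⟨rfl, _⟩ | ⟨rfl, _⟩)
      · exact h1 h.2.symm
      · exact h2 h.2.symm
  have hQu1 : P (c u) = {u} → Q (c u) = {u} := by
    intro h
    ext x
    simp only [Q, Finset.mem_sdiff, hZ, h, Finset.mem_singleton]
    clear * - huv'
    grind
  have hQu2 : P (c u) ≠ {u} → Q (c u) = (P (c u)).erase u := by
    intro h
    ext x
    simp only [Q, Finset.mem_sdiff, hZ, Finset.mem_erase, hP]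
    clear * - huv' hcuv h
    grind
  have hQv1 : P (c v) = {v} → Q (c v) = {v} := by
    intro h
    ext x
    simp only [Q, Finset.mem_sdiff, hZ, h, Finset.mem_singleton]
    clear * - huv'
    grind
  have hQv2 : P (c v) ≠ {v} → Q (c v) = (P (c v)).erase v := by
    intro h
    ext x
    simp only [Q, Finset.mem_sdiff, hZ, Finset.mem_erase, hP]
    clear * - huv' hcuv h
    grind
  have hsep : Separ G I Q := by
    intro i _ j _ hij x hx y hy
    have hx' := hQP _ _ hx
    have hy' := hQP _ _ hy
    refine ⟨fun h => hij (by rw [← hx'.2, ← hy'.2, h]), fun hxy => ?_⟩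
    have h1 := (Finset.mem_sdiff.1 hx).2
    have h2 := (Finset.mem_sdiff.1 hy).2
    rw [hZ] at h1 h2
    rcases hc x y hx'.1 hy'.1 hxy (by rw [hx'.2, hy'.2]; exact hij) with ⟨e1, e2⟩ | ⟨e1, e2⟩
    · exact hUV ⟨by_contra fun h => h1 (Or.inl ⟨e1, h⟩), by_contra fun h => h2 (Or.inr ⟨e2, h⟩)⟩
    · exact hUV ⟨by_contra fun h => h2 (Or.inl ⟨e2, h⟩), by_contra fun h => h1 (Or.inr ⟨e1, h⟩)⟩
  have hfu : 3 ≤ (S ∩ nb G (Q (c u))).card := by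
    by_cases h : P (c u) = {u}
    · rw [hQu1 h]; exact hU3' h
    · rw [hQu2 h]; exact hU3 h
  have hfi : ∀ i ∈ I, i ≠ c u → i ≠ c v → 3 ≤ (S ∩ nb G (Q i)).card ∧
      ((S ∩ nb G (Q i)).card ≤ 3 → Frag G (Q i)) := by
    intro i hi h1 h2
    rw [hQi i h1 h2, Finset.inter_eq_right.2 (hPnb i h1 h2)]
    have hr : ∃ r, r ∉ P i ∧ r ∉ nb G (P i) :=
      ⟨u, fun h => h1 ((hP _ _).1 h).2.symm, fun h => huS (hPnb i h1 h2 h)⟩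
    exact ⟨three_conn ht (hPne i hi) hr, fun h => ⟨hPne i hi, h, hr⟩⟩
  have hfv : 2 ≤ (S ∩ nb G (Q (c v))).card := by
    by_cases h : P (c v) = {v}
    · rw [hQv1 h]
      have := hV3' h
      omega
    · rw [hQv2 h]
      have h1 := three_conn ht (herase _ _ hvP h) hVr
      have := card_nb_le hVnb
      omega
  have hcount := count_le hcf hsep S
  have hgle : ∀ i ∈ I, (if i = c v then 2 else 3) ≤ (S ∩ nb G (Q i)).card := by
    intro i hi
    split_ifs with h
    · rw [h]; exact hfv
    · by_cases h' : i = c u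
      · rw [h']; exact hfu
      · exact (hfi i hi h' h).1
  have hgsum : ∑ i ∈ I, (if i = c v then 2 else 3) + 1 = 3 * I.card := by
    have h1 : ∑ i ∈ I, (if i = c v then 1 else 0) = 1 := by
      rw [Finset.sum_ite_eq' I (c v)]
      simp [hvI]
    have h2 : ∑ i ∈ I, (if i = c v then 2 else 3) + ∑ i ∈ I, (if i = c v then 1 else 0)
        = ∑ i ∈ I, 3 := by
      rw [← Finset.sum_add_distrib]
      apply Finset.sum_congr rfl
      intro i _
      split_ifs <;> rfl
    rw [h1] at h2
    rw [h2]
    simp [mul_comm]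
  have hle := Finset.sum_le_sum hgle
  have heq := (Finset.sum_eq_sum_iff_of_le hgle).1 (by omega)
  have hv2 : (S ∩ nb G (Q (c v))).card = 2 := by
    have := heq _ hvI
    simpa using this.symm
  have hVne : P (c v) ≠ {v} := by
    intro h
    have h1 := hV3' h
    rw [hQv1 h] at hv2
    omega
  have hvA : v ∉ A := by
    intro hvA
    have h1 := card_nb_ge_three ht hA hA2 (herase _ _ hvP hVne) hVr hvA hVnb
    rw [hQv2 hVne] at hv2
    omega
  have hSA : ∀ s ∈ S, s ∉ A := by
    intro s hs
    have : ∃ i ∈ I, i ≠ c u ∧ s ∈ nb G (Q i) := by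
      by_contra hcon
      push Not at hcon
      have := count_lt hcf hsep S hs hcon
      omega
    obtain ⟨i, hi, hiu, hsi⟩ := this
    refine mader ht hA hA2 ?_ hsi
    by_cases h : i = c v
    · subst h
      rw [hQv2 hVne] at hv2 ⊢
      have := card_nb_le hVnb
      exact ⟨herase _ _ hvP hVne, by omega, hVr⟩
    · apply (hfi i hi hiu h).2
      have := heq i hi
      simp only [h, if_false] at this
      omega
  have hAU : A ⊆ P (c u) := by
    apply atom_conn hA ⟨u, Finset.mem_inter.2 ⟨huA, huP⟩⟩
    intro x hx y hy hxU hyU hxy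
    have hxS : x ∉ S := fun h => hSA x h hx
    have hyS : y ∉ S := fun h => hSA y h hy
    rw [hP] at hxU hyU
    rcases hc x y hxS hyS hxy (fun h => hyU ⟨hyS, by rw [← h, hxU.2]⟩) with ⟨_, rfl⟩ | ⟨rfl, _⟩
    · exact hvA hy
    · exact hvA hx
  -- swap `v` with `u`
  have hvT : v ∈ nb G A := mem_nb.2 ⟨hvA, u, huA, huv⟩
  have hsub : nb G (A.erase u) ⊆ insert u ((nb G A).erase v) := by
    intro y hy
    obtain ⟨hy, x, hx, hxy⟩ := mem_nb.1 hy
    rw [Finset.mem_erase] at hx hy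
    rw [Finset.mem_insert, Finset.mem_erase]
    by_cases hyu : y = u
    · exact Or.inl hyu
    right
    refine ⟨?_, mem_nb.2 ⟨fun h => hy ⟨hyu, h⟩, x, hx.2, hxy⟩⟩
    rintro rfl
    have hxU := (hP _ _).1 (hAU hx.2)
    rcases hc x y hxU.1 hvS hxy (by rw [hxU.2]; exact hcuv) with ⟨h, _⟩ | ⟨_, h⟩
    · exact hx.1 h
    · exact hyu h
  obtain ⟨r, hr1, hr2⟩ := hA.1.2.2
  have hfr : Frag G (A.erase u) := by
    refine ⟨Finset.card_pos.1 ?_, ?_, r, ?_, ?_⟩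
    · rw [Finset.card_erase_of_mem huA]; omega
    · refine le_trans (Finset.card_le_card hsub) (le_trans (Finset.card_insert_le _ _) ?_)
      rw [Finset.card_erase_of_mem hvT]
      have := hA.1.2.1
      have := Finset.card_pos.2 ⟨v, hvT⟩
      omega
    · exact fun h => hr1 (Finset.mem_of_mem_erase h)
    · intro h
      have := hsub h
      rw [Finset.mem_insert, Finset.mem_erase] at this
      rcases this with rfl | h
      · exact hr1 huA
      · exact hr2 h.2
  have := hA.2 _ hfr
  rw [Finset.card_erase_of_mem huA] at this
  omega

/-- Number of neighbours of an edge touching an atom with at least three vertices. -/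
lemma edge_nb {G : SimpleGraph V} (ht : Tgh G) (hm : Mini G) (hcf : ClawFree G)
    {A : Finset V} (hA : Atom G A) (hA3 : 3 ≤ A.card) (hd : ∀ x, 4 ≤ (nb G {x}).card)
    {u v : V} (huA : u ∈ A) (huv : G.Adj u v) : (nb G {u, v}).card = 4 := by
  obtain ⟨S, I, Q, i0, hi0, hQ0, hne, hsep, hnb, hQS, hI2, hcard⟩ :=
    isolate ht hm hcf hA (by omega) hd huA huv
  have hr : ∀ i ∈ I, ∃ r, r ∉ Q i ∧ r ∉ nb G (Q i) := by
    intro i hi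
    obtain ⟨j, hj, hji⟩ := Finset.exists_mem_ne (by omega : 1 < I.card) i
    obtain ⟨y, hy⟩ := hne j hj
    exact ⟨y, fun h => (hsep i hi j hj hji.symm y h y hy).1 rfl,
      fun h => hQS j hj y hy (hnb i hi h)⟩
  have hge : ∀ i ∈ I, 3 ≤ (nb G (Q i)).card := fun i hi => three_conn ht (hne i hi) (hr i hi)
  have h0 := hge i0 hi0
  rw [hQ0] at h0
  by_contra hcon
  by_cases h3 : (nb G {u, v}).card = 3
  · have : Frag G {u, v} := ⟨by simp, by omega, by rw [← hQ0]; exact hr i0 hi0⟩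
    have h1 := hA.2 _ this
    have h2 : ({u, v} : Finset V).card ≤ 2 := Finset.card_le_two
    omega
  have h5 : 5 ≤ (nb G {u, v}).card := by omega
  have hgle : ∀ i ∈ I, (if i = i0 then 5 else 3) ≤ (S ∩ nb G (Q i)).card := by
    intro i hi
    rw [Finset.inter_eq_right.2 (hnb i hi)]
    split_ifs with h
    · rw [h, hQ0]; exact h5
    · exact hge i hi
  have hgsum : ∑ i ∈ I, (if i = i0 then 5 else 3) = 3 * I.card + 2 := by
    have h1 : ∑ i ∈ I, (if i = i0 then 2 else 0) = 2 := by
      rw [Finset.sum_ite_eq' I i0]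
      simp [hi0]
    have h2 : ∑ i ∈ I, (if i = i0 then 5 else 3) = ∑ i ∈ I, 3 +
        ∑ i ∈ I, (if i = i0 then 2 else 0) := by
      rw [← Finset.sum_add_distrib]
      apply Finset.sum_congr rfl
      intro i _
      split_ifs <;> rfl
    rw [h2, h1]
    simp [mul_comm]
  have hcount := count_le hcf hsep S
  have hle := Finset.sum_le_sum hgle
  have heq := (Finset.sum_eq_sum_iff_of_le hgle).1 (by omega)
  have hSA : ∀ s ∈ S, s ∉ A := by
    intro s hs
    have : ∃ i ∈ I, i ≠ i0 ∧ s ∈ nb G (Q i) := by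
      by_contra hcon
      push Not at hcon
      have := count_lt hcf hsep S hs hcon
      omega
    obtain ⟨i, hi, hiu, hsi⟩ := this
    refine mader ht hA (by omega) ⟨hne i hi, ?_, hr i hi⟩ hsi
    have := heq i hi
    rw [Finset.inter_eq_right.2 (hnb i hi)] at this
    simp only [hiu, if_false] at this
    omega
  have hsub : A ⊆ {u, v} := by
    apply atom_conn hA ⟨u, by simp [huA]⟩
    intro x hx y hy hxX hyX hxy
    have h1 := hnb i0 hi0
    rw [hQ0] at h1
    exact hSA y (h1 (mem_nb.2 ⟨hyX, x, hxX, hxy⟩)) hy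
  have h1 := Finset.card_le_card hsub
  have h2 : ({u, v} : Finset V).card ≤ 2 := Finset.card_le_two
  omega

/-- Every vertex in the boundary of an atom has a neighbour on the other side. -/
lemma bdry {G : SimpleGraph V} (ht : Tgh G) {A : Finset V} (hA : Frag G A) {t : V}
    (htA : t ∈ nb G A) : ∃ r, G.Adj t r ∧ r ∉ A ∧ r ∉ nb G A := by
  obtain ⟨hR, hsub⟩ := frag_compl hA
  have h3 := three_conn ht hR.1 hR.2.2
  have heq := Finset.eq_of_subset_of_card_le hsub (le_trans hA.2.1 h3)
  rw [← heq] at htA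
  obtain ⟨_, r, hr, hrt⟩ := mem_nb.1 htA
  simp only [Finset.mem_compl, Finset.mem_union, not_or] at hr
  exact ⟨r, hrt.symm, hr.1, hr.2⟩

lemma closed_univ {G : SimpleGraph V} (ht : Tgh G) {X : Finset V} (hX : X.Nonempty)
    (hcl : ∀ x ∈ X, ∀ y, G.Adj x y → y ∈ X) (r : V) : r ∈ X := by
  by_contra hr
  have h0 : nb G X = ∅ := by
    rw [Finset.eq_empty_iff_forall_notMem]
    intro y hy
    obtain ⟨hy, x, hx, hxy⟩ := mem_nb.1 hy
    exact hy (hcl x hx y hxy)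
  have := three_conn ht hX ⟨r, hr, by simp [h0]⟩
  simp [h0] at this

lemma local_struct {G : SimpleGraph V} (ht : Tgh G) {A : Finset V} (hA : Frag G A)
    (hd : ∀ x, 4 ≤ (nb G {x}).card)
    (hE : ∀ u v, u ∈ A → G.Adj u v → (nb G {u, v}).card = 4) {u : V} (hu : u ∈ A) :
    (nb G {u}).card = 4 ∧ ∀ v, G.Adj u v → ∃ o, G.Adj v o ∧ o ≠ u ∧ ¬ G.Adj u o ∧
      ∀ y, G.Adj v y → y ≠ u → ¬ G.Adj u y → y = o := by
  have key : ∀ v, G.Adj u v →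
      (nb G {u}).card + (nb G {v} \ insert u (nb G {u})).card = 5 := by
    intro v huv
    have h1 : nb G {u, v} = (nb G {u}).erase v ∪ (nb G {v} \ insert u (nb G {u})) := by
      ext y
      simp only [Finset.mem_union, Finset.mem_erase, Finset.mem_sdiff, Finset.mem_insert,
        mem_nb_single]
      rw [mem_nb]
      simp only [Finset.mem_insert, Finset.mem_singleton, exists_eq_or_imp, exists_eq_left]
      have := G.loopless
      have h1 : G.Adj u y → y ≠ u := fun h => h.ne'
      have h2 : G.Adj v y → y ≠ v := fun h => h.ne'
      tauto
    have h2 : Disjoint ((nb G {u}).erase v) (nb G {v} \ insert u (nb G {u})) := by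
      rw [Finset.disjoint_left]
      intro x hx hx'
      rw [Finset.mem_erase] at hx
      rw [Finset.mem_sdiff, Finset.mem_insert] at hx'
      tauto
    have h3 := hE u v hu huv
    have h4 : v ∈ nb G {u} := mem_nb_single.2 huv
    rw [h1, Finset.card_union_of_disjoint h2, Finset.card_erase_of_mem h4] at h3
    have := hd u
    omega
  obtain ⟨r, hr1, hr2⟩ := hA.2.2
  have h4 := hd u
  have hdeg : (nb G {u}).card = 4 := by
    by_contra hne
    have h0 : ∀ v, G.Adj u v → nb G {v} \ insert u (nb G {u}) = ∅ := by
      intro v huv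
      have := key v huv
      rw [← Finset.card_eq_zero]
      omega
    have := closed_univ ht (X := insert u (nb G {u})) (by simp) (by
      intro x hx y hxy
      rw [Finset.mem_insert, mem_nb_single] at hx
      rcases hx with rfl | hx
      · rw [Finset.mem_insert, mem_nb_single]
        exact Or.inr hxy
      · have := h0 x hx
        rw [Finset.sdiff_eq_empty_iff_subset] at this
        exact this (mem_nb_single.2 hxy)) r
    rw [Finset.mem_insert, mem_nb_single] at this
    rcases this with rfl | h
    · exact hr1 hu
    · exact hr2 (mem_nb.2 ⟨hr1, u, hu, h⟩)
  refine ⟨hdeg, fun v huv => ?_⟩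
  have := key v huv
  have h1 : (nb G {v} \ insert u (nb G {u})).card = 1 := by omega
  obtain ⟨o, ho⟩ := Finset.card_eq_one.1 h1
  have ho' : ∀ y, (G.Adj v y ∧ ¬ (y = u ∨ G.Adj u y)) ↔ y = o := by
    intro y
    have : y ∈ nb G {v} \ insert u (nb G {u}) ↔ y ∈ ({o} : Finset V) := by rw [ho]
    simpa only [Finset.mem_sdiff, Finset.mem_insert, mem_nb_single, Finset.mem_singleton]
      using this
  have h2 := (ho' o).2 rfl
  refine ⟨o, h2.1, fun h => h2.2 (Or.inl h), fun h => h2.2 (Or.inr h), fun y h3 h4 h5 => ?_⟩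
  exact (ho' y).1 ⟨h3, by tauto⟩

set_option maxHeartbeats 800000 in
lemma big_atom {G : SimpleGraph V} (ht : Tgh G) {A : Finset V} (hA : Atom G A)
    (hA3 : 3 ≤ A.card) (hd : ∀ x, 4 ≤ (nb G {x}).card)
    (hE : ∀ u v, u ∈ A → G.Adj u v → (nb G {u, v}).card = 4) : False := by
  have L := fun u hu => local_struct ht hA.1 hd hE (u := u) hu
  obtain ⟨u, hu⟩ := hA.1.1
  obtain ⟨r, hr1, hr2⟩ := hA.1.2.2
  have hrA : ∀ x ∈ A, ¬ G.Adj x r := fun x hx h => hr2 (mem_nb.2 ⟨hr1, x, hx, h⟩)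
  have : ∃ a ∈ A, G.Adj u a := by
    by_contra hcon
    push Not at hcon
    have hsub : A ⊆ {u} := by
      apply atom_conn hA ⟨u, by simp [hu]⟩
      intro x _ y hy hxu _
      rw [Finset.mem_singleton] at hxu
      subst hxu
      exact hcon y hy
    have := Finset.card_le_card hsub
    simp at this
    omega
  obtain ⟨a, ha, hua⟩ := this
  obtain ⟨hdu, Lu⟩ := L u hu
  obtain ⟨hda, La⟩ := L a ha
  obtain ⟨a', haa', ha'u, hua', hauniq⟩ := Lu a hua
  have hsplit : nb G {a} = insert u (insert a' (nb G {a} ∩ nb G {u})) := by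
    ext y
    simp only [Finset.mem_insert, Finset.mem_inter, mem_nb_single]
    constructor
    · intro h
      by_cases h1 : y = u
      · exact Or.inl h1
      by_cases h2 : G.Adj u y
      · exact Or.inr (Or.inr ⟨h, h2⟩)
      · exact Or.inr (Or.inl (hauniq y h h1 h2))
    · rintro (rfl | rfl | h)
      · exact hua.symm
      · exact haa'
      · exact h.1
  have hc2 : (nb G {a} ∩ nb G {u}).card = 2 := by
    have h1 : a' ∉ nb G {a} ∩ nb G {u} := by
      rw [Finset.mem_inter, mem_nb_single, mem_nb_single]; exact fun h => hua' h.2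
    have h2 : u ∉ insert a' (nb G {a} ∩ nb G {u}) := by
      rw [Finset.mem_insert, Finset.mem_inter, mem_nb_single, mem_nb_single]
      have : ¬ G.Adj u u := G.irrefl
      rintro (h | h)
      · exact ha'u h.symm
      · exact this h.2
    rw [hsplit, Finset.card_insert_of_notMem h2, Finset.card_insert_of_notMem h1] at hda
    omega
  obtain ⟨b, d, hbd, hbdeq⟩ := Finset.card_eq_two.1 hc2
  have hab2 : ∀ y, (G.Adj a y ∧ G.Adj u y) ↔ (y = b ∨ y = d) := by
    intro y
    have : y ∈ nb G {a} ∩ nb G {u} ↔ y ∈ ({b, d} : Finset V) := by rw [hbdeq]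
    simpa only [Finset.mem_inter, mem_nb_single, Finset.mem_insert, Finset.mem_singleton]
      using this
  obtain ⟨hab, hub⟩ := (hab2 b).2 (Or.inl rfl)
  obtain ⟨had, hud⟩ := (hab2 d).2 (Or.inr rfl)
  have hsub3 : ({a, b, d} : Finset V) ⊆ nb G {u} := by
    intro y hy
    simp only [Finset.mem_insert, Finset.mem_singleton] at hy
    rw [mem_nb_single]
    rcases hy with rfl | rfl | rfl <;> assumption
  have hc3 : ({a, b, d} : Finset V).card = 3 :=
    Finset.card_eq_three.2 ⟨a, b, d, hab.ne, had.ne, hbd, rfl⟩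
  have hc1 : (nb G {u} \ {a, b, d}).card = 1 := by
    rw [Finset.card_sdiff_of_subset hsub3]
    omega
  obtain ⟨e, he⟩ := Finset.card_eq_one.1 hc1
  have he' : ∀ y, (G.Adj u y ∧ ¬ (y = a ∨ y = b ∨ y = d)) ↔ y = e := by
    intro y
    have : y ∈ nb G {u} \ {a, b, d} ↔ y ∈ ({e} : Finset V) := by rw [he]
    simpa only [Finset.mem_sdiff, mem_nb_single, Finset.mem_insert, Finset.mem_singleton]
      using this
  obtain ⟨hue, hene⟩ := (he' e).2 rfl
  have hNu : ∀ y, G.Adj u y → y = a ∨ y = b ∨ y = d ∨ y = e := by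
    intro y hy
    have := he' y
    clear * - this hy
    tauto
  have hNa : ∀ y, G.Adj a y → y = u ∨ y = b ∨ y = d ∨ y = a' := by
    intro y hy
    have h1 := hab2 y
    have h2 := hauniq y hy
    clear * - h1 h2 hy
    tauto
  have hae : ¬ G.Adj a e := by
    intro h
    exact hene (Or.inr ((hab2 e).1 ⟨h, hue⟩))
  obtain ⟨o, heo, hou, huo, houniq⟩ := Lu e hue
  have hNe : ∀ y, G.Adj e y → y = u ∨ y = b ∨ y = d ∨ y = o := by
    intro y hy
    by_cases h1 : y = u
    · exact Or.inl h1
    by_cases h2 : G.Adj u y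
    · rcases hNu y h2 with rfl | h | h | rfl
      · exact absurd hy.symm hae
      · exact Or.inr (Or.inl h)
      · exact Or.inr (Or.inr (Or.inl h))
      · exact absurd hy G.irrefl
    · exact Or.inr (Or.inr (Or.inr (houniq y hy h1 h2)))
  have heb : G.Adj e b := by
    by_contra hcon
    have : nb G {e} ⊆ {u, d, o} := by
      intro y hy
      rw [mem_nb_single] at hy
      have h1 := hNe y hy
      have h2 : y ≠ b := by rintro rfl; exact hcon hy
      simp only [Finset.mem_insert, Finset.mem_singleton]
      clear * - h1 h2
      tauto
    have h1 := Finset.card_le_card this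
    have h2 : ({u, d, o} : Finset V).card ≤ 3 := Finset.card_le_three
    have := hd e
    omega
  have hed : G.Adj e d := by
    by_contra hcon
    have : nb G {e} ⊆ {u, b, o} := by
      intro y hy
      rw [mem_nb_single] at hy
      have h1 := hNe y hy
      have h2 : y ≠ d := by rintro rfl; exact hcon hy
      simp only [Finset.mem_insert, Finset.mem_singleton]
      clear * - h1 h2
      tauto
    have h1 := Finset.card_le_card this
    have h2 : ({u, b, o} : Finset V).card ≤ 3 := Finset.card_le_three
    have := hd e
    omega
  have hea : e ≠ a := fun h => hene (Or.inl h)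
  -- the unique neighbour of `b` (and of `d`) outside `N[a]` is `e`
  have huniq : ∀ x, G.Adj a x → G.Adj e x → ∀ y, G.Adj x y → y ≠ a → ¬ G.Adj a y → y = e := by
    intro x hax hex y hxy hya hay
    obtain ⟨p, _, _, _, hpuniq⟩ := La x hax
    rw [hpuniq y hxy hya hay, hpuniq e hex.symm hea hae]
  have hinA : ∀ x, G.Adj a x → G.Adj e x → x ∈ A := by
    intro x hax hex
    by_contra hxA
    obtain ⟨q, hxq, hq1, hq2⟩ := bdry ht hA.1 (mem_nb.2 ⟨hxA, a, ha, hax⟩)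
    have hq3 : ∀ z ∈ A, ¬ G.Adj z q := fun z hz h => hq2 (mem_nb.2 ⟨hq1, z, hz, h⟩)
    have := huniq x hax hex q hxq (fun h => hq1 (h ▸ ha)) (hq3 a ha)
    subst this
    exact hq3 u hu hue
  have hbA := hinA b hab heb
  have hdA := hinA d had hed
  have hout : ∀ x, (x = b ∨ x = d) → G.Adj a x → G.Adj u x → G.Adj e x → G.Adj x a' := by
    intro x hxbd hax hux hex
    obtain ⟨p, hxp, hpu, hup, hpuniq⟩ := Lu x hux
    by_cases h1 : G.Adj a p
    · rcases hNa p h1 with rfl | rfl | rfl | rfl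
      · exact absurd rfl hpu
      · exact absurd hub hup
      · exact absurd hud hup
      · exact hxp
    · have := huniq x hax hex p hxp (by rintro rfl; exact hup hua) h1
      subst this
      exact absurd hue hup
  have hba' := hout b (Or.inl rfl) hab hub heb
  have hda' := hout d (Or.inr rfl) had hud hed
  have ha'e : a' ≠ e := by rintro rfl; exact hua' hue
  obtain ⟨hdb, Lb⟩ := L b hbA
  have hNb : nb G {b} = {u, a, e, a'} := by
    symm
    apply Finset.eq_of_subset_of_card_le
    · intro y hy
      simp only [Finset.mem_insert, Finset.mem_singleton] at hy
      rw [mem_nb_single]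
      rcases hy with rfl | rfl | rfl | rfl
      · exact hub.symm
      · exact hab.symm
      · exact heb.symm
      · exact hba'
    · rw [hdb, Finset.card_insert_of_notMem, Finset.card_insert_of_notMem,
        Finset.card_insert_of_notMem, Finset.card_singleton]
      · simpa using ha'e.symm
      · simp only [Finset.mem_insert, Finset.mem_singleton, not_or]
        exact ⟨hea.symm, haa'.ne⟩
      · simp only [Finset.mem_insert, Finset.mem_singleton, not_or]
        exact ⟨hua.ne, hue.ne, ha'u.symm⟩
  have hNb' : ∀ y, G.Adj b y → y = u ∨ y = a ∨ y = e ∨ y = a' := by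
    intro y hy
    rw [← mem_nb_single, hNb] at hy
    simpa using hy
  have hbd' : ¬ G.Adj b d := by
    intro h
    rcases hNb' d h with h1 | h1 | h1 | h1
    · exact hud.ne h1.symm
    · exact had.ne h1.symm
    · exact hed.ne h1.symm
    · exact hua' (h1 ▸ hud)
  have hoa' : o = a' := by
    obtain ⟨p, _, _, _, hpuniq⟩ := Lb e heb.symm
    by_cases h1 : G.Adj b o
    · rcases hNb' o h1 with h | h | h | h
      · exact absurd h hou
      · exact absurd (h ▸ hua) huo
      · exact absurd (h ▸ hue) huo
      · exact h
    · have h2 := hpuniq o heo (by rintro rfl; exact huo hub) h1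
      have h3 := hpuniq d hed hbd.symm hbd'
      exact absurd (by rw [h2, ← h3]; exact hud) huo
  obtain ⟨hdd, Ld⟩ := L d hdA
  have hNd : nb G {d} = {u, a, e, a'} := by
    symm
    apply Finset.eq_of_subset_of_card_le
    · intro y hy
      simp only [Finset.mem_insert, Finset.mem_singleton] at hy
      rw [mem_nb_single]
      rcases hy with rfl | rfl | rfl | rfl
      · exact hud.symm
      · exact had.symm
      · exact hed.symm
      · exact hda'
    · rw [hdd, ← hdb, hNb]
  have hNd' : ∀ y, G.Adj d y → y = u ∨ y = a ∨ y = e ∨ y = a' := by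
    intro y hy
    rw [← mem_nb_single, hNd] at hy
    simpa using hy
  have hr := closed_univ ht (X := {u, a, b, d, e, a'}) (by simp) (by
    intro x hx y hxy
    simp only [Finset.mem_insert, Finset.mem_singleton] at hx ⊢
    rcases hx with rfl | rfl | rfl | rfl | rfl | rfl
    · have := hNu y hxy; clear * - this; tauto
    · have := hNa y hxy; clear * - this; tauto
    · have := hNb' y hxy; clear * - this; tauto
    · have := hNd' y hxy; clear * - this; tauto
    · have := hNe y hxy
      rw [hoa'] at this
      clear * - this
      tauto
    · by_cases h1 : G.Adj a y
      · have := hNa y h1; clear * - this; tauto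
      · by_cases h2 : y = a
        · exact Or.inr (Or.inl h2)
        · have := huniq x haa' (hoa' ▸ heo) y hxy h2 h1
          clear * - this
          tauto) r
  simp only [Finset.mem_insert, Finset.mem_singleton] at hr
  rcases hr with rfl | rfl | rfl | rfl | rfl | rfl
  · exact hr1 hu
  · exact hr1 ha
  · exact hr1 hbA
  · exact hr1 hdA
  · exact hrA u hu hue
  · exact hrA a ha haa'

lemma sum_lb {I : Finset V} {f : V → ℕ} {i0 : V} (hi : i0 ∈ I) (h : ∀ i ∈ I, 3 ≤ f i) :
    3 * I.card + f i0 ≤ ∑ i ∈ I, f i + 3 := by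
  rw [← Finset.add_sum_erase I f hi]
  have h1 : (I.erase i0).card • 3 ≤ ∑ i ∈ I.erase i0, f i :=
    Finset.card_nsmul_le_sum _ _ _ (fun i hi => h i (Finset.mem_of_mem_erase hi))
  rw [Finset.card_erase_of_mem hi, smul_eq_mul] at h1
  have := Finset.card_pos.2 ⟨i0, hi⟩
  omega

/-- In a two-vertex atom, every boundary vertex has a neighbour in the boundary. -/
lemma small_nb {G : SimpleGraph V} (ht : Tgh G) (hm : Mini G) (hcf : ClawFree G)
    {A : Finset V} (hA : Atom G A) (hA2 : 2 ≤ A.card) (hd : ∀ x, 4 ≤ (nb G {x}).card)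
    {u v : V} (huA : u ∈ A) (hvA : v ∈ A) (huv : G.Adj u v)
    (hT3 : (nb G A).card = 3)
    (huT : ∀ t ∈ nb G A, G.Adj u t)
    (hvN : ∀ y, G.Adj v y → y = u ∨ y ∈ nb G A) (hvT : ∀ t ∈ nb G A, G.Adj v t)
    {s : V} (hs : s ∈ nb G A) : ∃ t ∈ nb G A, G.Adj s t := by
  by_contra hcon
  push Not at hcon
  have hsA : s ∉ A := (mem_nb.1 hs).1
  have hAT : ∀ x ∈ A, x ∉ nb G A := fun x hx h => (mem_nb.1 h).1 hx
  have hsv : v ≠ s := fun h => hsA (h ▸ hvA)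
  obtain ⟨S, I, Q, i0, hi0, hQ0, hne, hsep, hnb, hQS, hI2, hcard⟩ :=
    isolate ht hm hcf hA hA2 hd huA (huT s hs)
  have hr : ∀ i ∈ I, ∃ r, r ∉ Q i ∧ r ∉ nb G (Q i) := by
    intro i hi
    obtain ⟨j, hj, hji⟩ := Finset.exists_mem_ne (by omega : 1 < I.card) i
    obtain ⟨y, hy⟩ := hne j hj
    exact ⟨y, fun h => (hsep i hi j hj hji.symm y h y hy).1 rfl,
      fun h => hQS j hj y hy (hnb i hi h)⟩
  have hge : ∀ i ∈ I, 3 ≤ (nb G (Q i)).card := fun i hi => three_conn ht (hne i hi) (hr i hi)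
  have hN0 := hnb i0 hi0
  rw [hQ0] at hN0
  have hN : ∀ y, y ≠ u → y ≠ s → (G.Adj u y ∨ G.Adj s y) → y ∈ nb G {u, s} := by
    intro y h1 h2 h3
    rw [mem_nb]
    refine ⟨by simp [h1, h2], ?_⟩
    rcases h3 with h3 | h3
    · exact ⟨u, by simp, h3⟩
    · exact ⟨s, by simp, h3⟩
  have hvN' : v ∈ nb G {u, s} := hN v huv.ne' hsv (Or.inl huv)
  have hTN : ∀ t ∈ nb G A, t ≠ s → t ∈ nb G {u, s} := fun t h1 h2 =>
    hN t (fun h => hAT u huA (h ▸ h1)) h2 (Or.inl (huT t h1))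
  have hlt : ∑ i ∈ I, (S ∩ nb G (Q i)).card < 2 * S.card := by
    apply count_lt hcf hsep S (hN0 hvN') (i0 := i0)
    intro i hi hii h
    obtain ⟨_, x, hx, hxv⟩ := mem_nb.1 h
    have h0 : x ∉ ({u, s} : Finset V) := by
      intro h1
      rw [← hQ0] at h1
      exact (hsep i hi i0 hi0 hii x hx x h1).1 rfl
    simp only [Finset.mem_insert, Finset.mem_singleton, not_or] at h0
    rcases hvN x hxv.symm with h1 | h1
    · exact h0.1 h1
    · exact hQS i hi x hx (hN0 (hTN x h1 h0.2))
  have hlb := sum_lb (f := fun i => (S ∩ nb G (Q i)).card) hi0 (fun i hi => by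
    show 3 ≤ (S ∩ nb G (Q i)).card
    rw [Finset.inter_eq_right.2 (hnb i hi)]
    exact hge i hi)
  have hlb2 : 3 * I.card + (nb G {u, s}).card ≤ ∑ i ∈ I, (S ∩ nb G (Q i)).card + 3 := by
    rw [← hQ0]
    simpa only [Finset.inter_eq_right.2 (hnb i0 hi0)] using hlb
  have hbig : insert v ((nb G A).erase s ∪ (nb G {s} \ {u, v})) ⊆ nb G {u, s} := by
    intro y hy
    simp only [Finset.mem_insert, Finset.mem_union, Finset.mem_erase, Finset.mem_sdiff,
      Finset.mem_singleton, mem_nb_single, not_or] at hy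
    rcases hy with rfl | ⟨h1, h2⟩ | ⟨h1, h2, h3⟩
    · exact hvN'
    · exact hTN y h2 h1
    · exact hN y h2 h1.ne' (Or.inr h1)
  have hc := Finset.card_le_card hbig
  rw [Finset.card_insert_of_notMem, Finset.card_union_of_disjoint,
    Finset.card_erase_of_mem hs] at hc
  · have h1 := Finset.le_card_sdiff {u, v} (nb G {s})
    have h2 : ({u, v} : Finset V).card ≤ 2 := Finset.card_le_two
    have := hd s
    omega
  · rw [Finset.disjoint_left]
    intro x hx hx'
    rw [Finset.mem_sdiff, mem_nb_single] at hx'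
    exact hcon x (Finset.mem_of_mem_erase hx) hx'.1
  · simp only [Finset.mem_union, Finset.mem_erase, Finset.mem_sdiff,
      Finset.mem_insert, Finset.mem_singleton, not_or]
    exact ⟨fun h => hAT v hvA h.2, fun h => h.2.2 trivial⟩

set_option maxHeartbeats 800000 in
lemma endgame {G : SimpleGraph V} (ht : Tgh G) (hm : Mini G)
    (hd : ∀ x, 4 ≤ (nb G {x}).card) {u v s1 s2 s3 : V} (huv : u ≠ v)
    (hu : ∀ y, G.Adj u y ↔ y = v ∨ y = s1 ∨ y = s2 ∨ y = s3)
    (hv : ∀ y, G.Adj v y ↔ y = u ∨ y = s1 ∨ y = s2 ∨ y = s3)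
    (h13 : s1 ≠ s3) (h12 : G.Adj s1 s2) (h23 : G.Adj s2 s3) : False := by
  obtain ⟨S, c, h1S, h2S, hc12, h2, h3, hc⟩ := mini' ht hm h12
  have hus1 : G.Adj u s1 := (hu _).2 (Or.inr (Or.inl rfl))
  have hus2 : G.Adj u s2 := (hu _).2 (Or.inr (Or.inr (Or.inl rfl)))
  have hus3 : G.Adj u s3 := (hu _).2 (Or.inr (Or.inr (Or.inr rfl)))
  have hvs1 : G.Adj v s1 := (hv _).2 (Or.inr (Or.inl rfl))
  have hvs2 : G.Adj v s2 := (hv _).2 (Or.inr (Or.inr (Or.inl rfl)))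
  have hvs3 : G.Adj v s3 := (hv _).2 (Or.inr (Or.inr (Or.inr rfl)))
  have hcom : ∀ w, G.Adj w s1 → G.Adj w s2 → w ∈ S := by
    intro w hw1 hw2
    by_contra hwS
    have e1 : c w = c s1 := by
      by_contra h
      rcases hc w s1 hwS h1S hw1 h with ⟨h, _⟩ | ⟨h, _⟩
      · exact hw1.ne h
      · exact hw2.ne h
    have e2 : c w = c s2 := by
      by_contra h
      rcases hc w s2 hwS h2S hw2 h with ⟨h, _⟩ | ⟨h, _⟩
      · exact hw1.ne h
      · exact hw2.ne h
    exact hc12 (e1.symm.trans e2)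
  have huS := hcom u hus1 hus2
  have hvS := hcom v hvs1 hvs2
  have hs3 : s3 ∉ S → c s3 = c s2 := by
    intro h3S
    by_contra h
    rcases hc s3 s2 h3S h2S h23.symm h with ⟨h, _⟩ | ⟨h, _⟩
    · exact h13 h.symm
    · exact h23.ne h.symm
  set I := Sᶜ.image c with hI
  have h1I : c s1 ∈ I := Finset.mem_image_of_mem _ (by simpa using h1S)
  by_cases hk : 3 ≤ I.card
  · let c2 : V → V := fun x => if x = u ∨ x = v ∨ c x = c s1 then c s2 else c x
    have hc2s : ∀ x, (x = u ∨ x = v ∨ c x = c s1 ∨ c x = c s2) → c2 x = c s2 := by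
      intro x hx
      simp only [c2]
      split_ifs with h
      · rfl
      · clear * - hx h
        tauto
    have hc2n : ∀ x, x ≠ u → x ≠ v → c x ≠ c s1 → c2 x = c x := by
      intro x h1 h2 h3
      simp only [c2]
      rw [if_neg (by clear * - h1 h2 h3; tauto)]
    have hS2 : ∀ x, x ∉ (S.erase u).erase v → x = u ∨ x = v ∨ x ∉ S := by
      intro x hx
      rw [Finset.mem_erase, Finset.mem_erase] at hx
      clear * - hx
      tauto
    have hA : ∀ x y, (x = u ∨ x = v) → y ∉ (S.erase u).erase v → G.Adj x y →
        c2 y = c s2 := by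
      intro x y hx hy hxy
      have hy' : y = u ∨ y = v ∨ y = s1 ∨ y = s2 ∨ y = s3 := by
        rcases hx with rfl | rfl
        · have := (hu y).1 hxy; clear * - this; tauto
        · have := (hv y).1 hxy; clear * - this; tauto
      apply hc2s
      rcases hS2 y hy with h | h | h
      · exact Or.inl h
      · exact Or.inr (Or.inl h)
      · rcases hy' with h' | h' | h' | h' | h'
        · exact Or.inl h'
        · exact Or.inr (Or.inl h')
        · exact Or.inr (Or.inr (Or.inl (by rw [h'])))
        · exact Or.inr (Or.inr (Or.inr (by rw [h'])))
        · exact Or.inr (Or.inr (Or.inr (by rw [h'] at h ⊢; exact hs3 h)))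
    have hresp : Resp G ((S.erase u).erase v) c2 := by
      intro x y hx hy hxy
      by_cases hx' : x = u ∨ x = v
      · rw [hA x y hx' hy hxy]
        apply hc2s
        exact hx'.elim Or.inl (fun h => Or.inr (Or.inl h))
      by_cases hy' : y = u ∨ y = v
      · rw [hA y x hy' hx hxy.symm]
        symm
        apply hc2s
        exact hy'.elim Or.inl (fun h => Or.inr (Or.inl h))
      rw [not_or] at hx' hy'
      have hxS : x ∉ S := ((hS2 x hx).resolve_left hx'.1).resolve_left hx'.2
      have hyS : y ∉ S := ((hS2 y hy).resolve_left hy'.1).resolve_left hy'.2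
      by_cases he : c x = c y
      · simp only [c2, he, hx'.1, hx'.2, hy'.1, hy'.2, false_or]
      · rcases hc x y hxS hyS hxy he with ⟨e1, e2⟩ | ⟨e1, e2⟩
        · rw [hc2s x (Or.inr (Or.inr (Or.inl (by rw [e1])))),
            hc2s y (Or.inr (Or.inr (Or.inr (by rw [e2]))))]
        · rw [hc2s x (Or.inr (Or.inr (Or.inr (by rw [e1])))),
            hc2s y (Or.inr (Or.inr (Or.inl (by rw [e2]))))]
    have himg : I.erase (c s1) ⊆ ((S.erase u).erase v)ᶜ.image c2 := by
      intro i hi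
      rw [Finset.mem_erase] at hi
      obtain ⟨x, hx, hxi⟩ := Finset.mem_image.1 hi.2
      rw [Finset.mem_compl] at hx
      refine Finset.mem_image.2 ⟨x, ?_, ?_⟩
      · rw [Finset.mem_compl, Finset.mem_erase, Finset.mem_erase]
        exact fun h => hx h.2.2
      · rw [hc2n x (fun h => hx (h ▸ huS)) (fun h => hx (h ▸ hvS)) (by rw [hxi]; exact hi.1), hxi]
    have h5 := Finset.card_le_card himg
    rw [Finset.card_erase_of_mem h1I] at h5
    have h6 := ht _ c2 hresp (by omega)
    rw [Finset.card_erase_of_mem (Finset.mem_erase.2 ⟨huv.symm, hvS⟩),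
      Finset.card_erase_of_mem huS] at h6
    omega
  · have hSeq : ({u, v} : Finset V) = S := by
      apply Finset.eq_of_subset_of_card_le
      · intro x hx
        simp only [Finset.mem_insert, Finset.mem_singleton] at hx
        rcases hx with rfl | rfl <;> assumption
      · rw [Finset.card_pair huv]
        omega
    have hSmem : ∀ x, x ∈ S ↔ x = u ∨ x = v := by
      intro x
      rw [← hSeq]
      simp
    have h3S : s3 ∉ S := by
      rw [hSmem]
      rintro (h | h)
      · exact hus3.ne h.symm
      · exact hvs3.ne h.symm
    have hs3' := hs3 h3S
    let X : Finset V := Finset.univ.filter (fun x => x ∉ S ∧ c x = c s1 ∧ x ≠ s1)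
    have hX : ∀ x, x ∈ X ↔ x ∉ S ∧ c x = c s1 ∧ x ≠ s1 := by intro x; simp [X]
    have hnbX : nb G X ⊆ {s1} := by
      intro y hy
      obtain ⟨hyX, x, hx, hxy⟩ := mem_nb.1 hy
      rw [hX] at hx hyX
      obtain ⟨hxS, hx1, hx2⟩ := hx
      rw [Finset.mem_singleton]
      by_contra hy1
      by_cases hyS : y ∈ S
      · have hxN : x = u ∨ x = v ∨ x = s1 ∨ x = s2 ∨ x = s3 := by
          rcases (hSmem y).1 hyS with rfl | rfl
          · have := (hu x).1 hxy.symm; clear * - this; tauto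
          · have := (hv x).1 hxy.symm; clear * - this; tauto
        rcases hxN with rfl | rfl | rfl | rfl | rfl
        · exact hxS huS
        · exact hxS hvS
        · exact hx2 rfl
        · exact hc12 hx1.symm
        · exact hc12 (hx1.symm.trans hs3')
      · rcases hc x y hxS hyS hxy (fun h => hyX ⟨hyS, h ▸ hx1, hy1⟩) with ⟨h, _⟩ | ⟨h, _⟩
        · exact hx2 h
        · exact hc12 (h ▸ hx1).symm
    have hX0 : X = ∅ := by
      by_contra hne
      have := three_conn ht (Finset.nonempty_iff_ne_empty.2 hne) ⟨s2, by
        rw [hX]; exact fun h => hc12 h.2.1.symm, fun h => by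
        have := hnbX h
        rw [Finset.mem_singleton] at this
        exact h12.ne this.symm⟩
      have h1 := Finset.card_le_card hnbX
      rw [Finset.card_singleton] at h1
      omega
    have hN1 : nb G {s1} ⊆ {u, v, s2} := by
      intro y hy
      rw [mem_nb_single] at hy
      simp only [Finset.mem_insert, Finset.mem_singleton]
      by_contra hcon
      push Not at hcon
      have hyS : y ∉ S := by rw [hSmem]; exact fun h => h.elim hcon.1 hcon.2.1
      by_cases he : c s1 = c y
      · have : y ∈ X := (hX y).2 ⟨hyS, he.symm, hy.ne'⟩
        simp [hX0] at this
      · rcases hc s1 y h1S hyS hy he with ⟨_, h⟩ | ⟨h, _⟩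
        · exact hcon.2.2 h
        · exact h12.ne h
    have h1 := Finset.card_le_card hN1
    have h2 : ({u, v, s2} : Finset V).card ≤ 3 := Finset.card_le_three
    have := hd s1
    omega

lemma small_atom {G : SimpleGraph V} (ht : Tgh G) (hm : Mini G) (hcf : ClawFree G)
    {A : Finset V} (hA : Atom G A) (hA2 : A.card = 2) (hd : ∀ x, 4 ≤ (nb G {x}).card) :
    False := by
  obtain ⟨u, v, huv, hAeq⟩ := Finset.card_eq_two.1 hA2
  have hmem : ∀ x, x ∈ A ↔ x = u ∨ x = v := by intro x; rw [hAeq]; simp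
  have hT3 : (nb G A).card = 3 :=
    le_antisymm hA.1.2.1 (three_conn ht hA.1.1 hA.1.2.2)
  have hAT : ∀ x ∈ A, x ∉ nb G A := fun x hx h => (mem_nb.1 h).1 hx
  have key : ∀ x y, x ∈ A → (∀ z, z ∈ A → z = x ∨ z = y) → y ∈ A → x ≠ y →
      nb G {x} = insert y (nb G A) := by
    intro x y hx hz hy hxy
    apply Finset.eq_of_subset_of_card_le
    · intro w hw
      rw [mem_nb_single] at hw
      rw [Finset.mem_insert]
      by_cases hwA : w ∈ A
      · rcases hz w hwA with h | h
        · exact absurd h hw.ne'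
        · exact Or.inl h
      · exact Or.inr (mem_nb.2 ⟨hwA, x, hx, hw⟩)
    · rw [Finset.card_insert_of_notMem (hAT y hy), hT3]
      exact hd x
  have huA : u ∈ A := (hmem u).2 (Or.inl rfl)
  have hvA : v ∈ A := (hmem v).2 (Or.inr rfl)
  have hNu := key u v huA (fun z hz => (hmem z).1 hz) hvA huv
  have hNv := key v u hvA (fun z hz => ((hmem z).1 hz).symm) huA huv.symm
  have hu' : ∀ y, G.Adj u y ↔ y = v ∨ y ∈ nb G A := by
    intro y; rw [← mem_nb_single, hNu, Finset.mem_insert]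
  have hv' : ∀ y, G.Adj v y ↔ y = u ∨ y ∈ nb G A := by
    intro y; rw [← mem_nb_single, hNv, Finset.mem_insert]
  have hsn := fun s hs => small_nb ht hm hcf hA (by omega) hd huA hvA ((hu' v).2 (Or.inl rfl)) hT3
    (fun t h => (hu' t).2 (Or.inr h)) (fun y h => (hv' y).1 h)
    (fun t h => (hv' t).2 (Or.inr h)) (s := s) hs
  obtain ⟨a, b, d, hab, had, hbd, hT⟩ := Finset.card_eq_three.1 hT3
  have hTm : ∀ x, x ∈ nb G A ↔ x = a ∨ x = b ∨ x = d := by intro x; rw [hT]; simp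
  have fin : ∀ s1 s2 s3, (∀ x, x ∈ nb G A ↔ x = s1 ∨ x = s2 ∨ x = s3) → s1 ≠ s3 →
      G.Adj s1 s2 → G.Adj s2 s3 → False := by
    intro s1 s2 s3 h1 h13 h12 h23
    refine endgame ht hm hd huv ?_ ?_ h13 h12 h23
    · intro y; rw [hu', h1]
    · intro y; rw [hv', h1]
  have sa := hsn a ((hTm a).2 (Or.inl rfl))
  have sb := hsn b ((hTm b).2 (Or.inr (Or.inl rfl)))
  have sd := hsn d ((hTm d).2 (Or.inr (Or.inr rfl)))
  have f1 := fin a b d hTm had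
  have f2 := fin b a d (fun x => by rw [hTm]; clear * -; tauto) hbd
  have f3 := fin a d b (fun x => by rw [hTm]; clear * -; tauto) hab
  obtain ⟨x, hx, hax⟩ := sa
  obtain ⟨y, hy, hby⟩ := sb
  obtain ⟨z, hz, hdz⟩ := sd
  rw [hTm] at hx hy hz
  clear * - f1 f2 f3 hx hy hz hax hby hdz
  have aux : ∀ p q w z' : V, (w = p ∨ w = q ∨ w = z') → G.Adj p w → G.Adj p q ∨ G.Adj p z' := by
    intro p q w z' h hp
    rcases h with h | h | h
    · exact absurd h.symm hp.ne
    · exact Or.inl (h ▸ hp)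
    · exact Or.inr (h ▸ hp)
  have ka := aux a b x d hx hax
  have kb := aux b a y d (by clear * - hy; tauto) hby
  have kd := aux d a z b (by clear * - hz; tauto) hdz
  rcases ka with ka | ka
  · rcases kd with kd | kd
    · exact f2 ka.symm kd.symm
    · exact f1 ka kd.symm
  · rcases kb with kb | kb
    · exact f2 kb ka
    · exact f3 ka kb.symm

lemma main_helper {G : SimpleGraph V} (hmt : MinimallyTough G (3 / 2)) (hcf : ClawFree G) :
    ∃ v, (nb G {v}).card = 3 := by
  by_contra hcon
  push Not at hcon
  have ht := tgh_of hmt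
  have hm := mini_of hmt
  obtain ⟨A, hA⟩ := exists_atom (exists_frag hcf hmt)
  have hd := deg_four ht hA.1 hcon
  have h1 := Finset.card_pos.2 hA.1.1
  by_cases h3 : 3 ≤ A.card
  · exact big_atom ht hA h3 hd (fun u v hu huv => edge_nb ht hm hcf hA h3 hd hu huv)
  by_cases h2 : A.card = 2
  · exact small_atom ht hm hcf hA h2 hd
  have h1' : A.card = 1 := by omega
  obtain ⟨a, ha⟩ := Finset.card_eq_one.1 h1'
  have h4 := hd a
  have h5 := hA.1.2.1
  rw [ha] at h5
  omega

end Helper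

/-- Every minimally `3/2`-tough, claw-free graph has a vertex of degree `3`. -/
theorem minimally_three_halves_tough_claw_free_degree_three [Fintype V]
    (G : SimpleGraph V) [DecidableRel G.Adj]
    (hmt : MinimallyTough G (3 / 2)) (hcf : ClawFree G) :
    ∃ v : V, G.degree v = 3 := by
  classical
  obtain ⟨v, hv⟩ := main_helper hmt hcf
  refine ⟨v, ?_⟩
  rw [← hv, ← SimpleGraph.card_neighborFinset_eq_degree]
  congr 1
  ext y
  rw [mem_nb_single, SimpleGraph.mem_neighborFinset]
end

section
/- Let G be a minimally t-tough, claw-free graph and e = uv a non-bridge edge of G with D(e) ≠ ∅, and set S₁ = N_{S(e)}(C(e)) − N_{S(e)}(D(e)). Then |S₁| ≤ ⌈t⌉−1 and 2t ≤ |N_{S(e)}(C(e))| ≤ 4t−1−|S₁|. Moreover, if |S₁| = 4t−1−|N_{S(e)}(C(e))|, then every vertex of S(e)−S₁ is contained in a 2t-vertex-cut of G. -/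
open SimpleGraph

variable {V : Type*}

section Helpers

open Finset Classical

theorem reach_closed {W : Type*} {H : SimpleGraph W} (P : W → Prop)
    (hP : ∀ a b, H.Adj a b → P a → P b) {a b : W} (h : H.Reachable a b) (ha : P a) : P b := by
  obtain ⟨p⟩ := h
  induction p with
  | nil => exact ha
  | cons hadj _ ih => exact ih (hP _ _ hadj ha)

theorem card_comp_le {W : Type*} [Finite W] (H H' : SimpleGraph W) (u v : W)
    (h : ∀ a b, H.Adj a b → H'.Adj a b ∨ (a = u ∧ b = v) ∨ (a = v ∧ b = u)) (hle : H' ≤ H) :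
    Nat.card H'.ConnectedComponent ≤ Nat.card H.ConnectedComponent + 1 := by
  have key : ∀ a b, H.Reachable a b → H'.Reachable a b ∨ (H'.Reachable a u ∧ H'.Reachable v b) ∨
      (H'.Reachable a v ∧ H'.Reachable u b) := by
    intro a b hab
    refine reach_closed (fun b => H'.Reachable a b ∨ (H'.Reachable a u ∧ H'.Reachable v b) ∨
      (H'.Reachable a v ∧ H'.Reachable u b)) ?_ hab (Or.inl (Reachable.refl a))
    intro x y hxy hx
    rcases h x y hxy with h1 | ⟨rfl, rfl⟩ | ⟨rfl, rfl⟩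
    · rcases hx with hx | ⟨hx, hx'⟩ | ⟨hx, hx'⟩
      · exact Or.inl (hx.trans h1.reachable)
      · exact Or.inr (Or.inl ⟨hx, hx'.trans h1.reachable⟩)
      · exact Or.inr (Or.inr ⟨hx, hx'.trans h1.reachable⟩)
    · rcases hx with hx | ⟨hx, hx'⟩ | ⟨hx, hx'⟩
      · exact Or.inr (Or.inl ⟨hx, Reachable.refl _⟩)
      · exact Or.inr (Or.inl ⟨hx, Reachable.refl _⟩)
      · exact Or.inl hx
    · rcases hx with hx | ⟨hx, hx'⟩ | ⟨hx, hx'⟩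
      · exact Or.inr (Or.inr ⟨hx, Reachable.refl _⟩)
      · exact Or.inl hx
      · exact Or.inr (Or.inr ⟨hx, Reachable.refl _⟩)
  let f : H'.ConnectedComponent → Option H.ConnectedComponent := fun c =>
    if c = H'.connectedComponentMk v then none else some (c.map (Hom.ofLE hle))
  have hf : Function.Injective f := by
    intro c d
    induction c using ConnectedComponent.ind with | _ a => ?_
    induction d using ConnectedComponent.ind with | _ b => ?_
    intro hcd
    simp only [f] at hcd
    split_ifs at hcd with h1 h2 h2
    · rw [h1, h2]
    · simp only [ConnectedComponent.map_mk, Option.some.injEq, ConnectedComponent.eq,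
        Hom.coe_ofLE, id] at hcd
      rw [ConnectedComponent.eq] at h1 h2 ⊢
      rcases key a b hcd with h3 | ⟨_, h3⟩ | ⟨h3, _⟩
      · exact h3
      · exact absurd h3.symm h2
      · exact absurd h3 h1
  calc _ ≤ Nat.card (Option H.ConnectedComponent) := Nat.card_le_card_of_injective f hf
    _ = _ := Finite.card_option

/-- Neighbours in `S` of a component of `G - S`. -/
noncomputable def cnb [Fintype V] (G : SimpleGraph V) (S : Finset V)
    (c : (G.induce (↑S : Set V)ᶜ).ConnectedComponent) : Finset V :=
  S.filter (fun x => ∃ y, (G.induce (↑S : Set V)ᶜ).connectedComponentMk y = c ∧ G.Adj x y.1)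

theorem two_le_of_not_reach [Fintype V] (G : SimpleGraph V) (T : Set V) (a b : ↥(Tᶜ))
    (h : ¬ (G.induce Tᶜ).Reachable a b) : 2 ≤ numComponents G T := by
  unfold numComponents
  have : Nontrivial ((G.induce Tᶜ).ConnectedComponent) :=
    ⟨_, _, fun hh => h (ConnectedComponent.eq.1 hh)⟩
  exact Finite.one_lt_card

theorem cnb_cut [Fintype V] (G : SimpleGraph V) (S : Finset V)
    (hS : 2 ≤ numComponents G ↑S) (c : (G.induce (↑S : Set V)ᶜ).ConnectedComponent) :
    2 ≤ numComponents G ↑(cnb G S c) := by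
  have : Nontrivial ((G.induce (↑S : Set V)ᶜ).ConnectedComponent) :=
    Finite.one_lt_card_iff_nontrivial.1 hS
  obtain ⟨d, hd⟩ := exists_ne c
  obtain ⟨a, ha⟩ := c.exists_rep
  obtain ⟨b, hb⟩ := d.exists_rep
  have hsub : ∀ y : ↥((↑S : Set V)ᶜ), y.1 ∈ ((cnb G S c : Finset V) : Set V)ᶜ := by
    intro y hy
    exact y.2 (Finset.mem_filter.1 hy).1
  refine two_le_of_not_reach G _ ⟨a.1, hsub a⟩ ⟨b.1, hsub b⟩ fun hr => ?_
  have := reach_closed (fun z => ∃ hz : z.1 ∈ (↑S : Set V)ᶜ,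
    (G.induce (↑S : Set V)ᶜ).connectedComponentMk ⟨z.1, hz⟩ = c) ?_ hr
    (Exists.intro (p := fun hz => (G.induce (↑S : Set V)ᶜ).connectedComponentMk ⟨a.1, hz⟩ = c) a.2 ha)
  · obtain ⟨hz, h⟩ := this
    exact hd (hb.symm.trans h)
  · rintro ⟨x, hx⟩ ⟨y, hy⟩ hxy ⟨hz, hc⟩
    have hxy' : G.Adj x y := hxy
    by_cases hyS : y ∈ S
    · exact absurd (Finset.mem_filter.2 ⟨hyS, ⟨x, hz⟩, hc, hxy'.symm⟩) hy
    · refine ⟨hyS, ?_⟩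
      refine Eq.trans (ConnectedComponent.eq.2 ?_) hc
      apply Adj.reachable
      exact hxy'.symm

theorem claw_count [Fintype V] (G : SimpleGraph V) (hcf : ClawFree G) (S : Finset V) (x : V) :
    (Finset.univ.filter (fun c => x ∈ cnb G S c)).card ≤ 2 := by
  by_contra hlt
  push Not at hlt
  obtain ⟨c₁, c₂, c₃, h1, h2, h3, h12, h13, h23⟩ := Finset.two_lt_card_iff.1 hlt
  simp only [cnb, Finset.mem_filter, Finset.mem_univ, true_and] at h1 h2 h3
  obtain ⟨_, a, ha, hxa⟩ := h1
  obtain ⟨_, b, hb, hxb⟩ := h2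
  obtain ⟨_, c, hc, hxc⟩ := h3
  have gen : ∀ p q : ↥((↑S : Set V)ᶜ), (G.induce (↑S : Set V)ᶜ).connectedComponentMk p ≠
      (G.induce (↑S : Set V)ᶜ).connectedComponentMk q → p.1 ≠ q.1 ∧ ¬ G.Adj p.1 q.1 := by
    intro p q hpq
    refine ⟨fun h => hpq (by rw [Subtype.ext h]), fun h => hpq ?_⟩
    rw [ConnectedComponent.eq]
    apply Adj.reachable
    exact h
  subst ha hb hc
  exact hcf ⟨x, a, b, c, (gen _ _ h12).1, (gen _ _ h13).1, (gen _ _ h23).1, hxa, hxb, hxc,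
    (gen _ _ h12).2, (gen _ _ h13).2, (gen _ _ h23).2⟩

theorem cnb_sum [Fintype V] (G : SimpleGraph V) (S : Finset V) :
    ∑ c, (cnb G S c).card = ∑ x ∈ S, (Finset.univ.filter (fun c => x ∈ cnb G S c)).card := by
  refine Eq.trans ?_ (Finset.sum_card_bipartiteAbove_eq_sum_card_bipartiteBelow (fun c x => x ∈ cnb G S c)
    (s := Finset.univ) (t := S))
  · refine Finset.sum_congr rfl fun c _ => congrArg _ ?_
    ext x
    simp only [Finset.bipartiteAbove, Finset.mem_filter]
    exact ⟨fun h => ⟨(Finset.mem_filter.1 h).1, h⟩, fun h => h.2⟩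

theorem cut_ge [Fintype V] {G : SimpleGraph V} {t : ℚ} (ht : HasToughness G t) (T : Finset V)
    (h : 2 ≤ numComponents G ↑T) : t * numComponents G ↑T ≤ T.card := by
  have := ht.1 T h
  have h0 : (0:ℚ) < numComponents G ↑T := by exact_mod_cast (by omega : 0 < numComponents G ↑T)
  rwa [le_div_iff₀ h0] at this

theorem cut_ge_two [Fintype V] {G : SimpleGraph V} {t : ℚ} (ht : HasToughness G t) (h0 : 0 < t)
    (T : Finset V) (h : 2 ≤ numComponents G ↑T) : 2 * t ≤ T.card := by
  have := cut_ge ht T h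
  have h2 : (2:ℚ) ≤ numComponents G ↑T := by exact_mod_cast h
  nlinarith

theorem two_t_nat [Fintype V] {G : SimpleGraph V} {t : ℚ} (ht : HasToughness G t) (h0 : 0 < t)
    (hcf : ClawFree G) : ∃ k : ℕ, (k : ℚ) = 2 * t := by
  obtain ⟨T, hT, hteq⟩ := ht.2
  have hw0 : (0:ℚ) < numComponents G ↑T := by exact_mod_cast (by omega : 0 < numComponents G ↑T)
  have hTc : t * numComponents G ↑T = T.card := by
    rw [hteq]; field_simp
  have : Nontrivial ((G.induce (↑T : Set V)ᶜ).ConnectedComponent) :=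
    Finite.one_lt_card_iff_nontrivial.1 hT
  have hup : ∑ c, (cnb G T c).card ≤ T.card * 2 := by
    rw [cnb_sum]
    exact Finset.sum_le_card_nsmul _ _ _ fun x _ => claw_count G hcf T x
  by_contra hno
  push Not at hno
  have hlt : ∑ c : (G.induce (↑T : Set V)ᶜ).ConnectedComponent, 2 * t
      < ∑ c, ((cnb G T c).card : ℚ) := by
    refine Finset.sum_lt_sum_of_nonempty Finset.univ_nonempty fun c _ => ?_
    exact lt_of_le_of_ne (cut_ge_two ht h0 _ (cnb_cut G T hT c)) (hno _).symm
  have hup' : ∑ c, ((cnb G T c).card : ℚ) ≤ T.card * 2 := by exact_mod_cast hup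
  rw [Finset.sum_const, nsmul_eq_mul, Finset.card_univ, ← Nat.card_eq_fintype_card] at hlt
  change (numComponents G ↑T : ℚ) * (2 * t) < _ at hlt
  nlinarith

theorem numComp_sdiff [Fintype V] (G : SimpleGraph V) (S : Finset V)
    (C : (G.induce (↑S : Set V)ᶜ).ConnectedComponent) (S' : Finset V) (hsub : S' ⊆ S)
    (hS' : ∀ x ∈ S, x ∉ S' → ∀ c, c ≠ C → x ∉ cnb G S c) :
    numComponents G ↑S ≤ numComponents G ↑S' := by
  have hss : (↑S : Set V)ᶜ ⊆ (↑S' : Set V)ᶜ := by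
    intro x hx hx'
    exact hx (hsub hx')
  have key : ∀ a b : ↥((↑S : Set V)ᶜ), (G.induce (↑S : Set V)ᶜ).connectedComponentMk a ≠ C →
      (G.induce (↑S' : Set V)ᶜ).Reachable ⟨a.1, hss a.2⟩ ⟨b.1, hss b.2⟩ →
      (G.induce (↑S : Set V)ᶜ).connectedComponentMk b =
      (G.induce (↑S : Set V)ᶜ).connectedComponentMk a := by
    intro a b ha hr
    have := reach_closed (fun z => ∃ hz : z.1 ∈ (↑S : Set V)ᶜ,
      (G.induce (↑S : Set V)ᶜ).connectedComponentMk ⟨z.1, hz⟩ =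
      (G.induce (↑S : Set V)ᶜ).connectedComponentMk a) ?_ hr ⟨a.2, rfl⟩
    · exact this.2
    · rintro ⟨x, hx⟩ ⟨y, hy⟩ hxy ⟨hz, hc⟩
      have hxy' : G.Adj x y := hxy
      by_cases hyS : y ∈ S
      · exact absurd (Finset.mem_filter.2 ⟨hyS, ⟨x, hz⟩, hc, hxy'.symm⟩) (hS' y hyS hy _ ha)
      · refine ⟨hyS, ?_⟩
        rw [← hc, ConnectedComponent.eq]
        apply Adj.reachable
        exact hxy'.symm
  refine Nat.card_le_card_of_injective
    (ConnectedComponent.map (induceHomOfLE G hss).toHom) ?_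
  intro c d
  induction c using ConnectedComponent.ind with | _ a => ?_
  induction d using ConnectedComponent.ind with | _ b => ?_
  intro hcd
  have hr : (G.induce (↑S' : Set V)ᶜ).Reachable ⟨a.1, hss a.2⟩ ⟨b.1, hss b.2⟩ :=
    ConnectedComponent.eq.1 hcd
  by_cases ha : (G.induce (↑S : Set V)ᶜ).connectedComponentMk a = C
  · by_cases hb : (G.induce (↑S : Set V)ᶜ).connectedComponentMk b = C
    · rw [ha, hb]
    · exact key b a hb hr.symm
  · exact (key a b ha hr).symm

end Helpers

/-- Let `G` be minimally `t`-tough and claw-free, `e = uv` a non-bridge edge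
with `D(e) ≠ ∅`, and `S₁ = N_{S(e)}(C(e)) − N_{S(e)}(D(e))`.  Then
`|S₁| ≤ ⌈t⌉ − 1` and `2t ≤ |N_{S(e)}(C(e))| ≤ 4t − 1 − |S₁|`.  Moreover, if
`|S₁| = 4t − 1 − |N_{S(e)}(C(e))|`, then every vertex of `S(e) − S₁` is
contained in a `2t`-vertex-cut of `G`. -/
theorem min_good_cut_S1_bounds [Fintype V] (G : SimpleGraph V)
    (t : ℚ) (hmt : MinimallyTough G t) (hcf : ClawFree G)
    (u v : V) (huv : G.Adj u v) (hnb : ¬ IsBridgeIn G (∅ : Set V) u v)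
    (S : Finset V) (hS : IsMinGoodCut G t u v S)
    (hD : (Dset G ↑S u).Nonempty)
    (S₁ : Set V)
    (hS₁ : S₁ = nbrsIn G ↑S (compOf G ↑S u) \ nbrsIn G ↑S (Dset G ↑S u)) :
    ((S₁.ncard : ℤ) ≤ ⌈t⌉ - 1) ∧
    (2 * t ≤ ((nbrsIn G ↑S (compOf G ↑S u)).ncard : ℚ)) ∧
    (((nbrsIn G ↑S (compOf G ↑S u)).ncard : ℚ) ≤ 4 * t - 1 - (S₁.ncard : ℚ)) ∧
    ((S₁.ncard : ℚ) = 4 * t - 1 - ((nbrsIn G ↑S (compOf G ↑S u)).ncard : ℚ) →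
      ∀ x ∈ (↑S : Set V) \ S₁, InTwoTCut G t x) := by
  classical
  obtain ⟨ht, hmin⟩ := hmt
  have h0 : 0 < t := by
    obtain ⟨T, _, hT⟩ := hmin u v huv
    exact lt_of_le_of_lt (by positivity) hT
  obtain ⟨k, hk⟩ := two_t_nat ht h0 hcf
  obtain ⟨⟨hg1, hg2, huS, hvS, _, _⟩, _⟩ := hS
  have huS' : u ∈ (↑S : Set V)ᶜ := huS
  have hvS' : v ∈ (↑S : Set V)ᶜ := hvS
  set w := numComponents G ↑S with hw
  have hw' : numComponents (G.deleteEdges {s(u, v)}) ↑S ≤ w + 1 := by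
    refine card_comp_le _ _ ⟨u, huS'⟩ ⟨v, hvS'⟩ ?_ ?_
    · rintro ⟨a, ha⟩ ⟨b, hb⟩ hab
      have hab' : G.Adj a b := hab
      simp only [Subtype.mk.injEq, comap_adj, Function.Embedding.subtype_apply, deleteEdges_adj,
        Set.mem_singleton_iff, Sym2.eq_iff]
      tauto
    · intro a b hab
      exact (show (G.deleteEdges {s(u, v)}).Adj a.1 b.1 from hab).1
  have hSlt : (S.card : ℚ) < t * (w + 1) := by
    have : (S.card : ℚ) / t < w + 1 := lt_of_lt_of_le hg2 (by exact_mod_cast hw')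
    rw [div_lt_iff₀ h0] at this
    linarith
  set C := (G.induce (↑S : Set V)ᶜ).connectedComponentMk ⟨u, huS'⟩ with hC
  have memC : ∀ y : ↥((↑S : Set V)ᶜ), y.1 ∈ compOf G ↑S u ↔
      (G.induce (↑S : Set V)ᶜ).connectedComponentMk y = C := by
    intro y
    rw [hC, ConnectedComponent.eq]
    exact ⟨fun ⟨_, _, h⟩ => h.symm, fun h => ⟨huS', y.2, h.symm⟩⟩
  have hw2 : 2 ≤ w := by
    obtain ⟨d, hd, hd'⟩ := hD
    refine two_le_of_not_reach G _ ⟨u, huS'⟩ ⟨d, hd⟩ fun h => hd' ⟨huS', hd, h⟩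
  have hNC : nbrsIn G ↑S (compOf G ↑S u) = ↑(cnb G S C) := by
    ext x
    simp only [nbrsIn, cnb, Set.mem_ofPred_eq, Finset.coe_filter]
    constructor
    · rintro ⟨⟨hx, _⟩, y, hy, hxy⟩
      exact ⟨hx, ⟨y, hy.2.1⟩, (memC ⟨y, hy.2.1⟩).1 hy, hxy⟩
    · rintro ⟨hx, y, hy, hxy⟩
      exact ⟨⟨hx, fun h => h.2.1 hx⟩, y.1, (memC y).2 hy, hxy⟩
  have hND : ∀ x, x ∈ nbrsIn G ↑S (Dset G ↑S u) ↔ ∃ c, c ≠ C ∧ x ∈ cnb G S c := by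
    intro x
    simp only [nbrsIn, cnb, Set.mem_ofPred_eq, Finset.mem_filter]
    constructor
    · rintro ⟨⟨hx, _⟩, y, hy, hxy⟩
      exact ⟨_, fun h => hy.2 ((memC ⟨y, hy.1⟩).2 h), hx, ⟨y, hy.1⟩, rfl, hxy⟩
    · rintro ⟨c, hc, hx, y, hy, hxy⟩
      exact ⟨⟨hx, fun h => h.1 hx⟩, y.1, ⟨y.2, fun h => hc (hy.symm.trans ((memC y).1 h))⟩, hxy⟩
  set F : Finset V := S.filter (fun x => x ∈ S₁) with hF
  have hS1F : S₁ = ↑F := by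
    ext x
    simp only [hF, Finset.coe_filter, Set.mem_ofPred_eq]
    refine ⟨fun h => ⟨?_, h⟩, fun h => h.2⟩
    rw [hS₁] at h
    exact h.1.1.1
  have hS1not : ∀ x ∈ S₁, ∀ c, c ≠ C → x ∉ cnb G S c := by
    intro x hx c hc hxc
    rw [hS₁] at hx
    exact hx.2 ((hND x).2 ⟨c, hc, hxc⟩)
  have hS1card : S₁.ncard = F.card := by rw [hS1F, Set.ncard_coe_finset]
  have hNCcard : (nbrsIn G ↑S (compOf G ↑S u)).ncard = (cnb G S C).card := by
    rw [hNC, Set.ncard_coe_finset]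
  rw [hS1card, hNCcard]
  have hFS : F ⊆ S := Finset.filter_subset _ _
  have hkle : ∀ c, k ≤ (cnb G S c).card := by
    intro c
    have := cut_ge_two ht h0 _ (cnb_cut G S hw2 c)
    rw [← hk] at this
    exact_mod_cast this
  -- first bound
  have hF1 : (F.card : ℚ) < t := by
    have h1 : w ≤ numComponents G ↑(S \ F) := by
      refine numComp_sdiff G S C _ Finset.sdiff_subset ?_
      intro x hx hx'
      refine hS1not x ?_
      simp only [Finset.mem_sdiff, not_and, not_not] at hx'
      exact (Finset.mem_filter.1 (hx' hx)).2
    have h2 := cut_ge ht (S \ F) (hw2.trans h1)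
    have h3 : ((S \ F).card : ℚ) + F.card = S.card := by
      exact_mod_cast Finset.card_sdiff_add_card_eq_card hFS
    have h4 : (w : ℚ) ≤ numComponents G ↑(S \ F) := by exact_mod_cast h1
    nlinarith
  -- double counting
  have hdx : ∀ x ∈ S, (Finset.univ.filter (fun c => x ∈ cnb G S c)).card +
      (if x ∈ S₁ then 1 else 0) ≤ 2 := by
    intro x hx
    split_ifs with h
    · have : Finset.univ.filter (fun c => x ∈ cnb G S c) ⊆ {C} := by
        intro c hc
        rw [Finset.mem_singleton]
        by_contra hne
        exact hS1not x h c hne (Finset.mem_filter.1 hc).2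
      have := Finset.card_le_card this
      rw [Finset.card_singleton] at this
      omega
    · exact claw_count G hcf S x
  have hsumeq : ∑ x ∈ S, ((Finset.univ.filter (fun c => x ∈ cnb G S c)).card +
      (if x ∈ S₁ then 1 else 0)) = ∑ c, (cnb G S c).card + F.card := by
    rw [Finset.sum_add_distrib, ← cnb_sum, hF, Finset.card_filter]
  have hup : ∑ c, (cnb G S c).card + F.card ≤ ∑ x ∈ S, 2 := by
    rw [← hsumeq]
    exact Finset.sum_le_sum hdx
  have hconst : ∑ x ∈ S, 2 = S.card * 2 := by simp
  have hsplit : ∑ c, (cnb G S c).card =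
      (cnb G S C).card + ∑ c ∈ Finset.univ.erase C, (cnb G S c).card :=
    (Finset.add_sum_erase _ _ (Finset.mem_univ C)).symm
  have hcardE : (Finset.univ.erase C).card + 1 = w := by
    rw [Finset.card_erase_add_one (Finset.mem_univ C), Finset.card_univ,
      ← Nat.card_eq_fintype_card]
    rfl
  have hconst2 : ∑ c ∈ Finset.univ.erase C, k = (Finset.univ.erase C).card * k := by simp
  have hlow : ∑ c ∈ Finset.univ.erase C, k ≤ ∑ c ∈ Finset.univ.erase C, (cnb G S c).card :=
    Finset.sum_le_sum fun c _ => hkle c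
  have h2S : S.card * 2 + 1 ≤ k * (w + 1) := by
    have : (S.card * 2 : ℚ) < k * (w + 1) := by rw [hk]; linarith
    have : S.card * 2 < k * (w + 1) := by exact_mod_cast this
    omega
  have hkw : k * (w + 1) = (Finset.univ.erase C).card * k + 2 * k := by
    rw [← hcardE]; ring
  refine ⟨?_, ?_, ?_, ?_⟩
  · have : (F.card : ℤ) < ⌈t⌉ := by
      rw [Int.lt_ceil]; exact_mod_cast hF1
    omega
  · rw [← hk]; exact_mod_cast hkle C
  · have : (cnb G S C).card + 1 + F.card ≤ 2 * k := by omega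
    have : ((cnb G S C).card : ℚ) + 1 + F.card ≤ 2 * k := by exact_mod_cast this
    linarith
  · intro heq x hx
    have heq' : (F.card : ℚ) + 1 + (cnb G S C).card = 2 * k := by linarith
    have heq'' : F.card + 1 + (cnb G S C).card = 2 * k := by exact_mod_cast heq'
    have e1 : ∑ x ∈ S, ((Finset.univ.filter (fun c => x ∈ cnb G S c)).card +
      (if x ∈ S₁ then 1 else 0)) = ∑ x ∈ S, 2 := by omega
    have e2 : ∑ c ∈ Finset.univ.erase C, k = ∑ c ∈ Finset.univ.erase C, (cnb G S c).card := by
      omega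
    have f1 := (Finset.sum_eq_sum_iff_of_le hdx).1 e1 x hx.1
    have f2 := (Finset.sum_eq_sum_iff_of_le fun c _ => hkle c).1 e2
    rw [if_neg hx.2] at f1
    obtain ⟨c, hc, hcC⟩ := Finset.exists_mem_ne (by omega : 1 < _) C (s :=
      Finset.univ.filter (fun c => x ∈ cnb G S c))
    refine ⟨cnb G S c, ?_, cnb_cut G S hw2 c, (Finset.mem_filter.1 hc).2⟩
    rw [← hk, ← f2 c (Finset.mem_erase.2 ⟨hcC, Finset.mem_univ c⟩)]
end
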